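/- Let G be a connected decomposable claw-free graph with maximum degree 3 such that χ'_irr(G) > 3 and every decomposable claw-free graph with maximum degree at most 3 and fewer edges than G has locally irregular chromatic index at most 3. Then every pair of adjacent vertices of degree 3 in G has a common neighbor; in particular, no two adjacent vertices lie in two distinct (vertex-disjoint apart from the connecting edge) triangles. -/

import Mathlib

/-- A graph is *locally irregular* if no two adjacent vertices have the same degree. -/
def LocallyIrregular {V : Type*} (G : SimpleGraph V) : Prop :=
  ∀ ⦃u v : V⦄, G.Adj u v → (G.neighborSet u).ncard ≠ (G.neighborSet v).ncard

/-- `HasLIEC G k` : `G` admits a locally irregular edge-coloring using at most `k` colors,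
i.e. an assignment of one of `k` colors to every edge such that the edges of each fixed
color induce a locally irregular graph. -/
def HasLIEC {V : Type*} (G : SimpleGraph V) (k : ℕ) : Prop :=
  ∃ c : Sym2 V → Fin k, ∀ i : Fin k,
    LocallyIrregular (SimpleGraph.fromEdgeSet {e | e ∈ G.edgeSet ∧ c e = i})

/-- A graph is *decomposable* if it admits a locally irregular edge-coloring. -/
def Decomposable {V : Type*} (G : SimpleGraph V) : Prop :=
  ∃ k : ℕ, HasLIEC G k

/-- A graph is *claw-free* if it contains no induced subgraph isomorphic to `K_{1,3}`. -/
def ClawFree {V : Type*} (G : SimpleGraph V) : Prop :=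
  ¬ ∃ v a b c : V, a ≠ b ∧ a ≠ c ∧ b ≠ c ∧
      G.Adj v a ∧ G.Adj v b ∧ G.Adj v c ∧ ¬ G.Adj a b ∧ ¬ G.Adj a c ∧ ¬ G.Adj b c

/-- `G` has maximum degree at most `d`. -/
def MaxDegreeLE {V : Type*} (G : SimpleGraph V) (d : ℕ) : Prop :=
  ∀ v : V, (G.neighborSet v).ncard ≤ d



/-- colour degree -/
noncomputable def cd {V : Type*} {k : ℕ} (G : SimpleGraph V) (c : V → V → Fin k) (i : Fin k)
    (x : V) : ℕ := {y | G.Adj x y ∧ c x y = i}.ncard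

def GoodCol {V : Type*} {k : ℕ} (G : SimpleGraph V) (c : V → V → Fin k) : Prop :=
  (∀ x y, c x y = c y x) ∧ ∀ x y, G.Adj x y → cd G c (c x y) x ≠ cd G c (c x y) y

lemma class_nbr {V : Type*} {k : ℕ} (G : SimpleGraph V) (c : Sym2 V → Fin k) (i : Fin k) (x : V) :
    (SimpleGraph.fromEdgeSet {e | e ∈ G.edgeSet ∧ c e = i}).neighborSet x
      = {y | G.Adj x y ∧ c s(x, y) = i} := by
  ext y
  simp only [SimpleGraph.mem_neighborSet, SimpleGraph.fromEdgeSet_adj, Set.mem_ofPred_eq,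
    SimpleGraph.mem_edgeSet]
  constructor
  · rintro ⟨h, _⟩; exact h
  · intro h; exact ⟨h, h.1.ne⟩

lemma hasLIEC_iff {V : Type*} (G : SimpleGraph V) (k : ℕ) :
    HasLIEC G k ↔ ∃ c : V → V → Fin k, GoodCol G c := by
  constructor
  · rintro ⟨c, hc⟩
    refine ⟨fun x y => c s(x, y), fun x y => by simp only [Sym2.eq_swap], ?_⟩
    intro x y h
    have := hc (c s(x, y)) (u := x) (v := y) (by
      simp only [SimpleGraph.fromEdgeSet_adj, Set.mem_ofPred_eq, SimpleGraph.mem_edgeSet]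
      exact ⟨⟨h, trivial⟩, h.ne⟩)
    rw [class_nbr, class_nbr] at this
    exact this
  · rintro ⟨c, hs, hc⟩
    refine ⟨Sym2.lift ⟨c, hs⟩, ?_⟩
    intro i x y h
    rw [class_nbr, class_nbr]
    simp only [SimpleGraph.fromEdgeSet_adj, Set.mem_ofPred_eq, SimpleGraph.mem_edgeSet,
      Sym2.lift_mk] at h ⊢
    obtain ⟨⟨h1, rfl⟩, _⟩ := h
    exact hc x y h1

lemma cd_comap {V W : Type*} {k : ℕ} (e : W ≃ V) (G : SimpleGraph V) (c : V → V → Fin k)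
    (i : Fin k) (x : W) :
    cd (G.comap e) (fun a b => c (e a) (e b)) i x = cd G c i (e x) := by
  unfold cd
  rw [← Set.ncard_image_of_injective _ e.injective]
  congr 1
  ext y
  simp only [SimpleGraph.comap_adj, Set.mem_image, Set.mem_ofPred_eq]
  constructor
  · rintro ⟨z, hz, rfl⟩; exact hz
  · intro h; exact ⟨e.symm y, by simpa using h, by simp⟩

lemma hasLIEC_comap {V W : Type*} {k : ℕ} (e : W ≃ V) (G : SimpleGraph V) (h : HasLIEC G k) :
    HasLIEC (G.comap e) k := by
  rw [hasLIEC_iff] at h ⊢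
  obtain ⟨c, hs, hc⟩ := h
  refine ⟨fun a b => c (e a) (e b), fun a b => hs _ _, fun a b hab => ?_⟩
  rw [cd_comap, cd_comap]
  exact hc _ _ hab

lemma min_transport {V : Type*} [Fintype V] (G : SimpleGraph V)
    (hmin : ∀ (W : Type) [Fintype W] (H : SimpleGraph W),
      Decomposable H → ClawFree H → MaxDegreeLE H 3 →
      H.edgeSet.ncard < G.edgeSet.ncard → HasLIEC H 3) (H : SimpleGraph V)
    (h1 : Decomposable H) (h2 : ClawFree H) (hle : H < G) (h3 : MaxDegreeLE G 3) :
    HasLIEC H 3 := by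
  classical
  let e : Fin (Fintype.card V) ≃ V := (Fintype.equivFin V).symm
  have key : HasLIEC (H.comap e) 3 := by
    refine hmin _ _ ?_ ?_ ?_ ?_
    · obtain ⟨k, hk⟩ := h1
      exact ⟨k, hasLIEC_comap e H hk⟩
    · rintro ⟨v, a, b, c, hab, hac, hbc, h⟩
      exact h2 ⟨e v, e a, e b, e c, by simpa using hab, by simpa using hac, by simpa using hbc, h⟩
    · intro v
      refine le_trans ?_ (h3 (e v))
      rw [← Set.ncard_image_of_injective _ e.injective]
      apply Set.ncard_le_ncard _ (Set.toFinite _)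
      rintro y ⟨z, hz, rfl⟩
      exact hle.le hz
    · refine lt_of_le_of_lt (b := H.edgeSet.ncard) ?_ ?_
      · rw [← Set.ncard_image_of_injective _ (Sym2.map.injective e.injective)]
        apply Set.ncard_le_ncard _ (Set.toFinite _)
        rintro y ⟨z, hz, rfl⟩
        induction z with
        | _ a b => simpa using hz
      · apply Set.ncard_lt_ncard _ (Set.toFinite _)
        exact SimpleGraph.edgeSet_strict_mono hle
  have := hasLIEC_comap e.symm _ key
  convert this using 1
  ext x y
  simp

lemma cd_pos {V : Type*} [Fintype V] {k : ℕ} {G : SimpleGraph V} {c : V → V → Fin k} {x y : V}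
    {i : Fin k} (h : G.Adj x y) (hc : c x y = i) : 1 ≤ cd G c i x := by
  unfold cd
  rw [Nat.one_le_iff_ne_zero, ← Nat.pos_iff_ne_zero, Set.ncard_pos (Set.toFinite _)]
  exact ⟨y, h, hc⟩

lemma cd_le {V : Type*} [Fintype V] {k : ℕ} {G : SimpleGraph V} {c : V → V → Fin k}
    (hd : MaxDegreeLE G 3) (x : V) (i : Fin k) : cd G c i x ≤ 3 := by
  refine le_trans ?_ (hd x)
  apply Set.ncard_le_ncard _ (Set.toFinite _)
  intro y hy; exact hy.1

lemma cd_add {V : Type*} [Fintype V] {k : ℕ} {G : SimpleGraph V} {c : V → V → Fin k}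
    (hd : MaxDegreeLE G 3) (x : V) {i j : Fin k} (hij : i ≠ j) : cd G c i x + cd G c j x ≤ 3 := by
  refine le_trans ?_ (hd x)
  unfold cd
  rw [← Set.ncard_union_eq _ (Set.toFinite _) (Set.toFinite _)]
  · apply Set.ncard_le_ncard _ (Set.toFinite _)
    rintro y (hy | hy) <;> exact hy.1
  · rw [Set.disjoint_left]
    rintro y ⟨_, h⟩ ⟨_, h'⟩
    exact hij (h.symm.trans h')

lemma cd_add3 {V : Type*} [Fintype V] {k : ℕ} {G : SimpleGraph V} {c : V → V → Fin k}
    (hd : MaxDegreeLE G 3) (x : V) {i j l : Fin k} (hij : i ≠ j) (hil : i ≠ l) (hjl : j ≠ l) :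
    cd G c i x + cd G c j x + cd G c l x ≤ 3 := by
  refine le_trans ?_ (hd x)
  unfold cd
  rw [← Set.ncard_union_eq _ (Set.toFinite _) (Set.toFinite _),
    ← Set.ncard_union_eq _ (Set.toFinite _) (Set.toFinite _)]
  · apply Set.ncard_le_ncard _ (Set.toFinite _)
    rintro y ((hy | hy) | hy) <;> exact hy.1
  · rw [Set.disjoint_left]
    rintro y (⟨_, h⟩ | ⟨_, h⟩) ⟨_, h'⟩
    · exact hil (h.symm.trans h')
    · exact hjl (h.symm.trans h')
  · rw [Set.disjoint_left]
    rintro y ⟨_, h⟩ ⟨_, h'⟩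
    exact hij (h.symm.trans h')

lemma cd_one_unique {V : Type*} [Fintype V] {k : ℕ} {G : SimpleGraph V} {c : V → V → Fin k}
    {x y z : V} {i : Fin k} (h : cd G c i x = 1) (hy : G.Adj x y) (hyc : c x y = i)
    (hz : G.Adj x z) (hzc : c x z = i) : y = z := by
  unfold cd at h
  rw [Set.ncard_eq_one] at h
  obtain ⟨w, hw⟩ := h
  have h1 : y ∈ ({w} : Set V) := hw ▸ ⟨hy, hyc⟩
  have h2 : z ∈ ({w} : Set V) := hw ▸ ⟨hz, hzc⟩
  rw [h1, h2]

/-- existence of another neighbour -/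
lemma cd_two_other {V : Type*} [Fintype V] {k : ℕ} {G : SimpleGraph V} {c : V → V → Fin k}
    {x y : V} {i : Fin k} (h : 2 ≤ cd G c i x) : ∃ z, z ≠ y ∧ G.Adj x z ∧ c x z = i := by
  unfold cd at h
  obtain ⟨z, hz, hzy⟩ := Set.exists_ne_of_one_lt_ncard (show 1 < _ from h) y
  exact ⟨z, hzy, hz.1, hz.2⟩

lemma cd_two_unique {V : Type*} [Fintype V] {k : ℕ} {G : SimpleGraph V} {c : V → V → Fin k}
    {x y z w : V} {i : Fin k} (h : cd G c i x = 2) (hy : G.Adj x y) (hyc : c x y = i)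
    (hz : G.Adj x z) (hzc : c x z = i) (hw : G.Adj x w) (hwc : c x w = i) (hyz : y ≠ z) :
    w = y ∨ w = z := by
  by_contra hcon
  push Not at hcon
  have : ({y, z, w} : Set V) ⊆ {y | G.Adj x y ∧ c x y = i} := by
    rintro t (rfl | rfl | rfl) <;> constructor <;> assumption
  have := Set.ncard_le_ncard this (Set.toFinite _)
  rw [Set.ncard_eq_three.2 ⟨y, z, w, hyz, hcon.1.symm, hcon.2.symm, rfl⟩] at this
  unfold cd at h
  omega

lemma cd_three {V : Type*} [Fintype V] {k : ℕ} {G : SimpleGraph V} {c : V → V → Fin k}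
    {x y : V} {i : Fin k} (h : cd G c i x = 3) (hy : G.Adj x y) (hyc : c x y = i) :
    ∃ p q, p ≠ y ∧ q ≠ y ∧ p ≠ q ∧ G.Adj x p ∧ c x p = i ∧ G.Adj x q ∧ c x q = i := by
  obtain ⟨p, hp, hp1, hp2⟩ := cd_two_other (x := x) (y := y) (i := i) (c := c) (G := G) (by omega)
  have : ∃ q ∈ {y | G.Adj x y ∧ c x y = i}, q ∉ ({y, p} : Set V) := by
    by_contra hcon
    push Not at hcon
    have h1 := Set.ncard_le_ncard (show {y | G.Adj x y ∧ c x y = i} ⊆ {y, p} from hcon)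
      (Set.toFinite _)
    have h2 : ({y, p} : Set V).ncard ≤ 2 := by
      simpa using Set.ncard_insert_le y {p}
    unfold cd at h
    omega
  obtain ⟨q, hq, hq'⟩ := this
  simp only [Set.mem_insert_iff, Set.mem_singleton_iff, not_or] at hq'
  exact ⟨p, q, hp, hq'.1, Ne.symm hq'.2, hp1, hp2, hq.1, hq.2⟩

def IsOri {V : Type*} (G : SimpleGraph V) (O : V → V → Prop) : Prop :=
  (∀ x y, O x y → G.Adj x y) ∧ (∀ x y, G.Adj x y → O x y ∨ O y x) ∧
  (∀ x y, O x y → ¬ O y x) ∧ ∀ x y, O x y → ∃ y', y' ≠ y ∧ O x y'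

def Leg {V : Type*} {k : ℕ} (G : SimpleGraph V) (c : V → V → Fin k) (i : Fin k) (x : V) : Prop :=
  cd G c i x = 2 ∧ ∃ l, G.Adj x l ∧ c x l = i ∧ cd G c i l = 1

def DOri {V : Type*} {k : ℕ} (G : SimpleGraph V) (c : V → V → Fin k) (x y : V) : Prop :=
  G.Adj x y ∧ (Leg G c (c x y) x ∨
    (¬ Leg G c (c x y) y ∧ cd G c (c x y) y < cd G c (c x y) x))

structure BadT {V : Type*} {k : ℕ} (G : SimpleGraph V) (c : V → V → Fin k) (w m p q : V) : Prop where
  wm : G.Adj w m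
  wp : G.Adj w p
  wq : G.Adj w q
  mp : G.Adj m p
  pq : p ≠ q
  mq : m ≠ q
  cp : c w p = c w m
  cq : c w q = c w m
  dw : cd G c (c w m) w = 3
  lp : Leg G c (c w m) p
  lq : Leg G c (c w m) q
  ne : c m p ≠ c w m
  djp : cd G c (c m p) p = 1
  djm : cd G c (c m p) m = 2
  dim : cd G c (c w m) m = 1

section ori
variable {V : Type*} [Fintype V] {k : ℕ} {G : SimpleGraph V} {c : V → V → Fin k}

lemma bad_wm (hd : MaxDegreeLE G 3) {w m p q w' p' q' : V} (h : BadT G c w m p q)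
    (h' : BadT G c w' w p' q') : False := by
  by_cases e : c w m = c w' w
  · have := h.dw; have := h'.dim; rw [e] at *; omega
  · have := cd_add (c := c) hd w e; have := h.dw; have := h'.dim; omega

lemma bad_wp (hd : MaxDegreeLE G 3) {w m p q w' m' q' : V} (h : BadT G c w m p q)
    (h' : BadT G c w' m' w q') : False := by
  have h2 := h'.lp.1
  by_cases e : c w m = c w' m'
  · have := h.dw; rw [e] at *; omega
  · have := cd_add (c := c) hd w e; have := h.dw; omega

lemma bad_mp (hs : ∀ x y, c x y = c y x) (hd : MaxDegreeLE G 3) {w x p q w' m' q' : V}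
    (h : BadT G c w x p q) (h' : BadT G c w' m' x q') : False := by
  have h2 := h'.lp.1
  have h3 := h.djm
  have h4 := h.dim
  have h5 := h'.djp
  have e1 : c w' m' = c x p := by
    by_contra e
    have := cd_add (c := c) hd x e; omega
  have e2 : c m' x = c w x := by
    by_contra e
    have n1 : c x p ≠ c m' x := fun h => by rw [h] at h3; omega
    have := cd_add3 (c := c) hd x n1 h.ne (Ne.symm e).symm
    omega
  have e3 : m' = w := cd_one_unique h4 h'.mp.symm (by rw [hs, e2]) h.wm.symm (hs _ _)
  subst e3
  have := h'.djm
  have := h.dw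
  rw [e2] at *
  omega

lemma bad_mm (hs : ∀ x y, c x y = c y x) (hd : MaxDegreeLE G 3) {w x p q w' p' q' : V}
    (h : BadT G c w x p q) (h' : BadT G c w' x p' q') : w = w' := by
  have h3 := h.djm
  have h4 := h.dim
  have h5 := h'.dim
  have n1 : c x p ≠ c w' x := fun h => by rw [h] at h3; omega
  have e2 : c w' x = c w x := by
    by_contra e
    have := cd_add3 (c := c) hd x n1 h.ne e
    omega
  exact cd_one_unique h4 h.wm.symm (hs _ _) h'.wm.symm (by rw [hs, e2])

lemma leg_other {x y : V} {i : Fin k} (h : Leg G c i x) : ∃ z, z ≠ y ∧ G.Adj x z ∧ c x z = i :=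
  cd_two_other h.1.ge

/-- a vertex with one owned edge in the default orientation is bad -/
lemma dori_single (hs : ∀ x y, c x y = c y x) (hd : MaxDegreeLE G 3)
    (hc : ∀ x y, G.Adj x y → cd G c (c x y) x ≠ cd G c (c x y) y) (hcl : ClawFree G) {x y : V}
    (h : DOri G c x y) : (∃ y', y' ≠ y ∧ DOri G c x y') ∨ ∃ m p q, BadT G c x m p q := by
  obtain ⟨hxy, hl | ⟨hl, hlt⟩⟩ := h
  · left
    obtain ⟨z, hz, hz1, hz2⟩ := leg_other (y := y) hl
    exact ⟨z, hz, hz1, Or.inl (by rw [hz2]; exact hl)⟩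
  by_cases hlx : Leg G c (c x y) x
  · left
    obtain ⟨z, hz, hz1, hz2⟩ := leg_other (y := y) hlx
    exact ⟨z, hz, hz1, Or.inl (by rw [hz2]; exact hlx)⟩
  have h1 := cd_pos hxy.symm (hs y x)
  have h3 := cd_le (c := c) hd x (c x y)
  have hx3 : cd G c (c x y) x = 3 := by
    by_contra hne
    exact hlx ⟨by omega, y, hxy, rfl, by omega⟩
  obtain ⟨p, q, hpy, hqy, hpq, hp, hpc, hq, hqc⟩ := cd_three hx3 hxy rfl
  have aux : ∀ z, G.Adj x z → c x z = c x y → ¬ Leg G c (c x y) z → DOri G c x z := by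
    intro z hz hzc hzl
    refine ⟨hz, Or.inr ?_⟩
    rw [hzc]
    refine ⟨hzl, ?_⟩
    have := hc x z hz
    have := cd_le (c := c) hd z (c x y)
    rw [hzc] at *
    omega
  by_cases lp : Leg G c (c x y) p
  swap
  · exact Or.inl ⟨p, hpy, aux p hp hpc lp⟩
  by_cases lq : Leg G c (c x y) q
  swap
  · exact Or.inl ⟨q, hqy, aux q hq hqc lq⟩
  right
  have mk : ∀ p q, p ≠ y → q ≠ y → p ≠ q → G.Adj x p → c x p = c x y → G.Adj x q →
      c x q = c x y → Leg G c (c x y) p → Leg G c (c x y) q → G.Adj y p → BadT G c x y p q := by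
    intro p q hpy hqy hpq hp hpc hq hqc lp lq hyp
    have hne : c y p ≠ c x y := by
      intro e
      obtain ⟨l2, l, hl1, hl2, hl3⟩ := lp
      have hxl : x ≠ l := by
        rintro rfl; omega
      have := cd_two_unique l2 hp.symm (by rw [hs, hpc]) hl1 hl2 hyp.symm (by rw [hs, e]) hxl
      rcases this with rfl | rfl
      · exact hxy.ne rfl
      · have := cd_one_unique hl3 hl1.symm (by rw [hs, hl2]) hxy.symm (hs _ _)
        exact hp.ne this.symm
    have a1 := cd_add (c := c) hd p hne
    have a2 := cd_pos hyp.symm (hs p y)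
    have a3 := lp.1
    have a4 := cd_add (c := c) hd y hne
    have a5 := cd_pos hyp (rfl : c y p = c y p)
    have a6 := hc y p hyp
    exact ⟨hxy, hp, hq, hyp, hpq, hqy.symm, hpc, hqc, hx3, lp, lq, hne, by omega, by omega, by omega⟩
  by_cases a1 : G.Adj y p
  · exact ⟨y, p, q, mk p q hpy hqy hpq hp hpc hq hqc lp lq a1⟩
  by_cases a2 : G.Adj y q
  · exact ⟨y, q, p, mk q p hqy hpy hpq.symm hq hqc hp hpc lq lp a2⟩
  by_cases a3 : G.Adj p q
  · exfalso
    have := hc p q a3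
    have l1 := lp.1
    have l2 := lq.1
    by_cases e : c p q = c x y
    · rw [e] at this; omega
    · have b1 := cd_add (c := c) hd p e
      have b2 := cd_add (c := c) hd q e
      have b3 := cd_pos a3 (rfl : c p q = c p q)
      have b4 := cd_pos a3.symm (hs q p)
      omega
  · exact (hcl ⟨x, y, p, q, hpy.symm, hqy.symm, hpq, hxy, hp, hq, a1, a2, a3⟩).elim

lemma exists_ori (hcl : ClawFree G) (hd : MaxDegreeLE G 3) (hg : GoodCol G c) :
    ∃ O, IsOri G O := by
  classical
  obtain ⟨hs, hc⟩ := hg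
  -- choice of bad triples
  obtain ⟨Ch, hCh, hfun, hex⟩ : ∃ Ch : V → V → V → Prop,
      (∀ w m p, Ch w m p → ∃ q, BadT G c w m p q) ∧
      (∀ w m p m' p', Ch w m p → Ch w m' p' → m = m' ∧ p = p') ∧
      (∀ w m p q, BadT G c w m p q → ∃ m' p', Ch w m' p') := by
    refine ⟨fun w m p => ∃ h : (∃ t : V × V, ∃ q, BadT G c w t.1 t.2 q), h.choose = (m, p),
      ?_, ?_, ?_⟩
    · rintro w m p ⟨h, e⟩
      have := h.choose_spec
      rw [e] at this
      exact this
    · rintro w m p m' p' ⟨h, e⟩ ⟨h', e'⟩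
      have := e.symm.trans e'
      simpa using this
    · rintro w m p q h
      have h0 : (∃ t : V × V, ∃ q, BadT G c w t.1 t.2 q) := ⟨(m, p), q, h⟩
      exact ⟨h0.choose.1, h0.choose.2, h0, rfl⟩
  have n1 : ∀ {w m p w' p'}, Ch w m p → Ch w' w p' → False := fun h h' => by
    obtain ⟨q, h⟩ := hCh _ _ _ h; obtain ⟨q', h'⟩ := hCh _ _ _ h'; exact bad_wm hd h h'
  have n2 : ∀ {w m p w' m'}, Ch w m p → Ch w' m' w → False := fun h h' => by
    obtain ⟨q, h⟩ := hCh _ _ _ h; obtain ⟨q', h'⟩ := hCh _ _ _ h'; exact bad_wp hd h h'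
  have n3 : ∀ {w x p w' m'}, Ch w x p → Ch w' m' x → False := fun h h' => by
    obtain ⟨q, h⟩ := hCh _ _ _ h; obtain ⟨q', h'⟩ := hCh _ _ _ h'; exact bad_mp hs hd h h'
  have n4 : ∀ {w x p w' p'}, Ch w x p → Ch w' x p' → w = w' ∧ p = p' := fun h h' => by
    obtain ⟨q, g⟩ := hCh _ _ _ h; obtain ⟨q', g'⟩ := hCh _ _ _ h'
    have := bad_mm hs hd g g'
    subst this
    exact ⟨rfl, (hfun _ _ _ _ _ h h').2⟩
  have dtot : ∀ x y, G.Adj x y → DOri G c x y ∨ DOri G c y x := by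
    intro x y h
    have := hc x y h
    unfold DOri
    rw [hs y x]
    by_cases l1 : Leg G c (c x y) x
    · exact Or.inl ⟨h, Or.inl l1⟩
    by_cases l2 : Leg G c (c x y) y
    · exact Or.inr ⟨h.symm, Or.inl l2⟩
    rcases lt_or_gt_of_ne this with h1 | h1
    · exact Or.inr ⟨h.symm, Or.inr ⟨l1, h1⟩⟩
    · exact Or.inl ⟨h, Or.inr ⟨l2, h1⟩⟩
  have danti : ∀ x y, DOri G c x y → ¬ DOri G c y x := by
    rintro x y ⟨h, h1⟩ ⟨_, h2⟩
    rw [hs y x] at h2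
    have := hc x y h
    rcases h1 with h1 | h1 <;> rcases h2 with h2 | h2
    · exact this (h1.1.trans h2.1.symm)
    · exact h2.1 h1
    · exact h1.1 h2
    · omega
  let O : V → V → Prop := fun x y =>
    (DOri G c x y ∧ ¬ (∃ p, Ch x y p) ∧ ¬ (∃ w, Ch w x y)) ∨ (∃ p, Ch y x p) ∨ (∃ w, Ch w y x)
  -- default directions of chosen edges
  have dwm : ∀ {w m p}, Ch w m p → DOri G c w m := fun h => by
    obtain ⟨q, h⟩ := hCh _ _ _ h
    refine ⟨h.wm, Or.inr ⟨fun l => ?_, ?_⟩⟩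
    · have := l.1; have := h.dim; omega
    · have := h.dw; have := h.dim; omega
  have dmp : ∀ {w m p}, Ch w m p → DOri G c m p := fun h => by
    obtain ⟨q, h⟩ := hCh _ _ _ h
    exact ⟨h.mp, Or.inl ⟨h.djm, _, h.mp, rfl, h.djp⟩⟩
  refine ⟨O, ?_, ?_, ?_, ?_⟩
  · rintro x y (h | ⟨p, h⟩ | ⟨w, h⟩)
    · exact h.1.1
    · obtain ⟨q, h⟩ := hCh _ _ _ h; exact h.wm.symm
    · obtain ⟨q, h⟩ := hCh _ _ _ h; exact h.mp.symm
  · intro x y h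
    by_cases a1 : ∃ p, Ch x y p
    · exact Or.inr (Or.inr (Or.inl a1))
    by_cases a2 : ∃ w, Ch w x y
    · exact Or.inr (Or.inr (Or.inr a2))
    by_cases a3 : ∃ p, Ch y x p
    · exact Or.inl (Or.inr (Or.inl a3))
    by_cases a4 : ∃ w, Ch w y x
    · exact Or.inl (Or.inr (Or.inr a4))
    rcases dtot x y h with h | h
    · exact Or.inl (Or.inl ⟨h, a1, a2⟩)
    · exact Or.inr (Or.inl ⟨h, a3, a4⟩)
  · rintro x y (⟨h, h1, h2⟩ | ⟨p, h⟩ | ⟨w, h⟩) (⟨g, g1, g2⟩ | ⟨p', g⟩ | ⟨w', g⟩)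
    · exact danti _ _ h g
    · exact h1 ⟨_, g⟩
    · exact h2 ⟨_, g⟩
    · exact g1 ⟨_, h⟩
    · exact n1 h g
    · exact n2 h g
    · exact g2 ⟨_, h⟩
    · exact n2 g h
    · exact n3 g h
  · intro x y hO
    by_cases c1 : ∃ w m, Ch w m x
    · obtain ⟨w, m, h⟩ := c1
      obtain ⟨q, hb⟩ := hCh _ _ _ h
      have o1 : O x m := Or.inr (Or.inr ⟨w, h⟩)
      have o2 : O x w := Or.inl ⟨⟨hb.wp.symm, Or.inl (by rw [hs, hb.cp]; exact hb.lp)⟩,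
        fun ⟨p, h'⟩ => n2 h' h, fun ⟨w', h'⟩ => n3 h' h⟩
      by_cases e : y = m
      · exact ⟨w, by rw [e]; exact hb.wm.ne, o2⟩
      · exact ⟨m, Ne.symm e, o1⟩
    by_cases c2 : ∃ w p, Ch w x p
    · obtain ⟨w, p, h⟩ := c2
      obtain ⟨q, hb⟩ := hCh _ _ _ h
      have o1 : O x w := Or.inr (Or.inl ⟨p, h⟩)
      have hlx : Leg G c (c x p) x := ⟨hb.djm, _, hb.mp, rfl, hb.djp⟩
      obtain ⟨z, hz, hz1, hz2⟩ := leg_other (y := p) hlx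
      have o2 : O x z := Or.inl ⟨⟨hz1, Or.inl (by rw [hz2]; exact hlx)⟩,
        fun ⟨p', h'⟩ => n1 h' h, fun ⟨w', h'⟩ => hz (n4 h' h).2⟩
      by_cases e : y = w
      · refine ⟨z, ?_, o2⟩
        rw [e]
        rintro rfl
        exact hb.ne (by rw [hs z x, hz2])
      · exact ⟨w, Ne.symm e, o1⟩
    have hD : ∀ z, O x z → DOri G c x z ∧ ¬ ∃ p, Ch x z p := by
      rintro z (⟨h, h1, h2⟩ | ⟨p, h⟩ | ⟨w, h⟩)
      · exact ⟨h, h1⟩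
      · exact (c2 ⟨_, _, h⟩).elim
      · exact (c1 ⟨_, _, h⟩).elim
    by_cases c3 : ∃ m p, Ch x m p
    · exfalso
      obtain ⟨m, p, h⟩ := c3
      obtain ⟨q, hb⟩ := hCh _ _ _ h
      obtain ⟨hxy, hy⟩ := hD y hO
      have hall : ∀ z, G.Adj x z → z = m ∨ z = p ∨ z = q := by
        intro z hz
        by_contra hcon
        push Not at hcon
        have hsub : ({m, p, q} : Set V) ⊆ {y | G.Adj x y ∧ c x y = c x m} := by
          rintro t (rfl | rfl | rfl)
          · exact ⟨hb.wm, rfl⟩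
          · exact ⟨hb.wp, hb.cp⟩
          · exact ⟨hb.wq, hb.cq⟩
        have hsub' : insert z ({m, p, q} : Set V) ⊆ G.neighborSet x := by
          rintro t (rfl | ht)
          · exact hz
          · exact (hsub ht).1
        have := Set.ncard_le_ncard hsub' (Set.toFinite _)
        rw [Set.ncard_insert_of_notMem (by simpa using hcon) (Set.toFinite _),
          Set.ncard_eq_three.2 ⟨m, p, q, hb.mp.ne, hb.mq, hb.pq, rfl⟩] at this
        have := hd x
        omega
      have nleg : ∀ z, c x z = c x m → Leg G c (c x m) z → ¬ DOri G c x z := by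
        rintro z hz hl ⟨_, h | h⟩
        · have := h.1; rw [hz] at this; have := hb.dw; omega
        · rw [hz] at h; exact h.1 hl
      rcases hall y hxy.1 with rfl | rfl | rfl
      · exact hy ⟨_, h⟩
      · exact nleg _ hb.cp hb.lp hxy
      · exact nleg _ hb.cq hb.lq hxy
    have hD' : ∀ z, DOri G c x z → O x z := fun z hz =>
      Or.inl ⟨hz, fun ⟨p, h⟩ => c3 ⟨_, _, h⟩, fun ⟨w, h⟩ => c2 ⟨_, _, h⟩⟩
    rcases dori_single hs hd hc hcl (hD y hO).1 with ⟨y', h1, h2⟩ | ⟨m, p, q, h⟩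
    · exact ⟨y', h1, hD' _ h2⟩
    · obtain ⟨m', p', h'⟩ := hex _ _ _ _ h
      exact (c3 ⟨_, _, h'⟩).elim

end ori

section hole
variable {V : Type*} [Fintype V] {G : SimpleGraph V} {O : V → V → Prop}

/-- edges whose owner is outside `T` -/
def HT (O : V → V → Prop) (hO : ∀ x y, O x y → ¬ O y x) (T : Set V) : SimpleGraph V where
  Adj x y := (O x y ∧ x ∉ T) ∨ (O y x ∧ y ∉ T)
  symm := ⟨fun x y h => h.symm⟩
  loopless := ⟨fun x h => by
    rcases h with h | h <;> exact hO x x h.1 h.1⟩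

lemma HT_le (hO : IsOri G O) (T : Set V) : HT O hO.2.2.1 T ≤ G := by
  rintro x y (h | h)
  · exact hO.1 _ _ h.1
  · exact (hO.1 _ _ h.1).symm

lemma HT_lt (hO : IsOri G O) (T : Set V) {x y : V} (hx : x ∈ T) (h : O x y) :
    HT O hO.2.2.1 T < G := by
  refine lt_of_le_of_ne (HT_le hO T) fun e => ?_
  have : (HT O hO.2.2.1 T).Adj x y := by rw [e]; exact hO.1 _ _ h
  rcases this with h' | h'
  · exact h'.2 hx
  · exact hO.2.2.1 _ _ h h'.1

lemma HT_dec (hO : IsOri G O) (T : Set V) : Decomposable (HT O hO.2.2.1 T) := by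
  classical
  refine ⟨Fintype.card V, ?_⟩
  rw [hasLIEC_iff]
  obtain ⟨h1, h2, h3, h4⟩ := hO
  let f := Fintype.equivFin V
  let c : V → V → Fin (Fintype.card V) := fun x y =>
    if O x y then f x else if O y x then f y else f (Classical.choice ⟨x⟩)
  have hx : ∀ x y, O x y → c x y = f x := fun x y h => by simp [c, h]
  have hy : ∀ x y, O x y → c y x = f x := fun x y h => by simp [c, h, h3 _ _ h]
  let c' : V → V → Fin (Fintype.card V) := fun x y =>
    if O x y ∨ O y x then c x y else f (Classical.choice ⟨x⟩)
  have hx : ∀ x y, O x y → c' x y = f x := fun x y h => by simp [c', h, hx _ _ h]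
  have hy : ∀ x y, O x y → c' y x = f x := fun x y h => by simp [c', h, hy _ _ h]
  have key : ∀ x y, O x y → x ∉ T → cd (HT O h3 T) c' (f x) x ≠ cd (HT O h3 T) c' (f x) y := by
    intro x y h hT
    have e1 : cd (HT O h3 T) c' (f x) y = 1 := by
      unfold cd
      rw [Set.ncard_eq_one]
      refine ⟨x, ?_⟩
      ext z
      simp only [Set.mem_ofPred_eq, Set.mem_singleton_iff]
      constructor
      · rintro ⟨g | g, e⟩
        · rw [hx _ _ g.1] at e
          have := f.injective e
          subst this
          exact (h3 _ _ h h).elim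
        · rw [hy _ _ g.1] at e
          exact f.injective e
      · rintro rfl
        exact ⟨Or.inr ⟨h, hT⟩, hy _ _ h⟩
    obtain ⟨y', hne, h'⟩ := h4 x y h
    have e2 : 2 ≤ cd (HT O h3 T) c' (f x) x := by
      unfold cd
      rw [← Set.ncard_pair hne]
      apply Set.ncard_le_ncard _ (Set.toFinite _)
      rintro t (rfl | rfl)
      · exact ⟨Or.inl ⟨h', hT⟩, hx _ _ h'⟩
      · exact ⟨Or.inl ⟨h, hT⟩, hx _ _ h⟩
    omega
  by_cases hn : Nonempty V
  swap
  · have : IsEmpty V := not_nonempty_iff.1 hn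
    exact ⟨c', fun x => (IsEmpty.false x).elim, fun x => (IsEmpty.false x).elim⟩
  obtain ⟨v0⟩ := hn
  refine ⟨fun x y => if O x y ∨ O y x then c' x y else f v0, ?_, ?_⟩
  · intro x y
    by_cases a : O x y
    · simp [a, hx _ _ a, hy _ _ a]
    · by_cases b : O y x
      · simp [b, hx _ _ b, hy _ _ b]
      · simp [a, b]
  · have ecd : ∀ i x, cd (HT O h3 T) (fun x y => if O x y ∨ O y x then c' x y else f v0) i x
        = cd (HT O h3 T) c' i x := by
      intro i x
      unfold cd
      congr 1
      ext y
      simp only [Set.mem_ofPred_eq]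
      refine and_congr_right fun h => ?_
      have : O x y ∨ O y x := h.imp And.left And.left
      simp [this]
    intro x y h
    rw [ecd, ecd]
    rcases h with h | h
    · simp only [h.1, true_or, if_true, hx _ _ h.1]
      exact key _ _ h.1 h.2
    · simp only [h.1, or_true, if_true, hy _ _ h.1]
      exact (key _ _ h.1 h.2).symm

lemma HT_claw (hO : IsOri G O) (T : Set V) (hcl : ClawFree G)
    (h : ∀ x y z, x ∉ T → y ∈ T → O x y → (HT O hO.2.2.1 T).Adj x z → G.Adj y z → False) :
    ClawFree (HT O hO.2.2.1 T) := by
  have key : ∀ x y z, (HT O hO.2.2.1 T).Adj x y → (HT O hO.2.2.1 T).Adj x z →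
      ¬ (HT O hO.2.2.1 T).Adj y z → ¬ G.Adj y z := by
    have step : ∀ x y z, (HT O hO.2.2.1 T).Adj x y → (HT O hO.2.2.1 T).Adj x z →
      y ∈ T → ¬ G.Adj y z := by
      intro x y z hy hz hT hyz
      rcases hy with hy | hy
      · exact h x y z hy.2 hT hy.1 hz hyz
      · exact hy.2 hT
    intro x y z hy hz hn hyz
    by_cases a : y ∈ T
    · exact step x y z hy hz a hyz
    by_cases b : z ∈ T
    · exact step x z y hz hy b hyz.symm
    rcases hO.2.1 _ _ hyz with g | g
    · exact hn (Or.inl ⟨g, a⟩)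
    · exact hn (Or.inr ⟨g, b⟩)
  rintro ⟨v, a, b, c, hab, hac, hbc, ha, hb, hc, nab, nac, nbc⟩
  exact hcl ⟨v, a, b, c, hab, hac, hbc, HT_le hO T ha, HT_le hO T hb, HT_le hO T hc,
    key _ _ _ ha hb nab, key _ _ _ ha hc nac, key _ _ _ hb hc nbc⟩

/-- Extend a colouring of `H` to `G` with fresh colours at outer vertices. -/
lemma fresh_ext (hd : MaxDegreeLE G 3) {H : SimpleGraph V} (hle : H ≤ G) (W : Set V)
    (hW : ∀ x y, G.Adj x y → ¬ H.Adj x y → x ∈ W ∨ y ∈ W)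
    (cH : V → V → Fin 3) (hs : ∀ x y, cH x y = cH y x) :
    ∃ c : V → V → Fin 3, (∀ x y, c x y = c y x) ∧ (∀ x y, H.Adj x y → c x y = cH x y) ∧
      ∀ x y, x ∉ W → H.Adj x y → cd G c (c x y) x = cd H cH (c x y) x := by
  classical
  have hfree : ∀ x y, x ∉ W → G.Adj x y → ¬ H.Adj x y →
      ∃ k : Fin 3, ∀ z, H.Adj x z → cH x z ≠ k := by
    intro x y hx hG hH
    by_contra hcon
    push Not at hcon
    choose g hg1 hg2 using hcon
    have hinj : Function.Injective g := fun i j e => by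
      rw [← hg2 i, ← hg2 j, e]
    have h1 : insert y (Set.range g) ⊆ G.neighborSet x := by
      rintro t (rfl | ⟨i, rfl⟩)
      · exact hG
      · exact hle (hg1 i)
    have h2 := Set.ncard_le_ncard h1 (Set.toFinite _)
    rw [Set.ncard_insert_of_notMem (by rintro ⟨i, rfl⟩; exact hH (hg1 i)) (Set.toFinite _)] at h2
    rw [← Set.image_univ, Set.ncard_image_of_injective _ hinj, Set.ncard_univ,
      Nat.card_eq_fintype_card, Fintype.card_fin] at h2
    have := hd x
    omega
  let P : V → V → Fin 3 → Prop := fun x y k =>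
    (x ∉ W → ∀ z, H.Adj x z → cH x z ≠ k) ∧ (y ∉ W → ∀ z, H.Adj y z → cH y z ≠ k)
  have Psymm : ∀ x y, P x y = P y x := fun x y => by
    funext k; exact propext and_comm
  let c : V → V → Fin 3 := fun x y => if H.Adj x y then cH x y else
    if h : ∃ k, P x y k then h.choose else 0
  have hcs : ∀ x y, c x y = c y x := by
    intro x y
    simp only [c]
    have e : H.Adj x y ↔ H.Adj y x := H.adj_comm x y
    simp only [e, hs x y, Psymm x y]
  have hcH : ∀ x y, H.Adj x y → c x y = cH x y := fun x y h => by simp [c, h]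
  refine ⟨c, hcs, hcH, ?_⟩
  intro x y hx hxy
  unfold cd
  congr 1
  ext z
  simp only [Set.mem_ofPred_eq]
  constructor
  · rintro ⟨h1, h2⟩
    by_cases h3 : H.Adj x z
    · exact ⟨h3, by rw [← hcH _ _ h3, h2]⟩
    · exfalso
      obtain ⟨k, hk⟩ := hfree x z hx h1 h3
      have hex : ∃ k, P x z k := by
        refine ⟨k, fun _ => hk, fun hz => ?_⟩
        rcases hW x z h1 h3 with h | h
        · exact (hx h).elim
        · exact (hz h).elim
      have hcz : P x z (c x z) := by
        have : c x z = hex.choose := by simp only [c, h3, if_false, hex, dif_pos]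
        rw [this]; exact hex.choose_spec
      exact hcz.1 hx y hxy (by rw [h2, hcH _ _ hxy])
  · rintro ⟨h1, h2⟩
    exact ⟨hle h1, by rw [hcH _ _ h1, h2]⟩

end hole

/-! gadgets -/

/-- degree in the gadget -/
def gdeg {n : ℕ} (K : Fin n → Fin n → Bool) (s : Fin n → Option (Fin 3 × Fin 3))
    (κ : Fin n → Fin n → Fin 3) (k : Fin 3) (i : Fin n) : ℕ :=
  (Finset.univ.filter (fun j => K i j = true ∧ κ i j = k)).card +
    (if (s i).map Prod.fst = some k then 1 else 0)

def GValid {n : ℕ} (K : Fin n → Fin n → Bool) (s : Fin n → Option (Fin 3 × Fin 3))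
    (κ : Fin n → Fin n → Fin 3) : Prop :=
  (∀ i j, κ i j = κ j i) ∧
  (∀ i j, K i j = true → gdeg K s κ (κ i j) i ≠ gdeg K s κ (κ i j) j) ∧
  ∀ i k D, s i = some (k, D) → gdeg K s κ k i ≠ D.val + 1

/-- `s i` describes the outer edge at `φ i` -/
def StateAt {V : Type*} (G : SimpleGraph V) (c : V → V → Fin 3) {n : ℕ} (φ : Fin n → V)
    (i : Fin n) (si : Option (Fin 3 × Fin 3)) : Prop :=
  (si = none ∧ ∀ y, G.Adj (φ i) y → y ∈ Set.range φ) ∨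
  ∃ x, x ∉ Set.range φ ∧ G.Adj (φ i) x ∧ (∀ y, G.Adj (φ i) y → y ∈ Set.range φ ∨ y = x) ∧
    ∃ D : Fin 3, si = some (c (φ i) x, D) ∧ cd G c (c (φ i) x) x = D.val + 1

section gadget
variable {V : Type*} [Fintype V] {G : SimpleGraph V}

lemma inner_count {n : ℕ} {φ : Fin n → V} (hφ : Function.Injective φ) (P : V → Prop)
    (Q : Fin n → Prop) [DecidablePred Q] (h : ∀ j, P (φ j) ↔ Q j) :
    {y | y ∈ Set.range φ ∧ P y}.ncard = (Finset.univ.filter Q).card := by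
  rw [← Set.ncard_coe_finset, ← Set.ncard_image_of_injective _ hφ]
  congr 1
  ext y
  simp only [Set.mem_ofPred_eq, Set.mem_range, Finset.coe_filter, Finset.mem_univ, true_and,
    Set.mem_image]
  constructor
  · rintro ⟨⟨j, rfl⟩, hj⟩; exact ⟨j, (h j).1 hj, rfl⟩
  · rintro ⟨j, hj, rfl⟩; exact ⟨⟨j, rfl⟩, (h j).2 hj⟩

lemma state_exists (hd : MaxDegreeLE G 3) {n : ℕ} {φ : Fin n → V} (hφ : Function.Injective φ)
    (K : Fin n → Fin n → Bool) (hK : ∀ i j, G.Adj (φ i) (φ j) ↔ K i j = true)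
    (hK2 : ∀ i, 2 ≤ (Finset.univ.filter (fun j => K i j = true)).card)
    (c : V → V → Fin 3) (hs : ∀ x y, c x y = c y x) (i : Fin n) : ∃ si, StateAt G c φ i si := by
  by_cases h : ∃ x, x ∉ Set.range φ ∧ G.Adj (φ i) x
  · obtain ⟨x, hx, hix⟩ := h
    have h1 := cd_pos hix.symm (hs x (φ i))
    have h2 := cd_le (c := c) hd x (c (φ i) x)
    refine ⟨some (c (φ i) x, ⟨cd G c (c (φ i) x) x - 1, by omega⟩), Or.inr
      ⟨x, hx, hix, ?_, _, rfl, by simp only; omega⟩⟩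
    intro y hy
    by_contra hcon
    push Not at hcon
    have hc := inner_count hφ (fun y => G.Adj (φ i) y) (fun j => K i j = true) (hK i)
    have hsub : insert x (insert y {y | y ∈ Set.range φ ∧ G.Adj (φ i) y}) ⊆ G.neighborSet (φ i) := by
      rintro t (rfl | rfl | ht)
      · exact hix
      · exact hy
      · exact ht.2
    have h3 := Set.ncard_le_ncard hsub (Set.toFinite _)
    rw [Set.ncard_insert_of_notMem _ (Set.toFinite _),
      Set.ncard_insert_of_notMem _ (Set.toFinite _), hc] at h3
    · have := hd (φ i); have := hK2 i; omega
    · exact fun h => hcon.1 h.1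
    · rintro (h | h)
      · exact hcon.2 h.symm
      · exact hx h.1
  · push Not at h
    exact ⟨none, Or.inl ⟨rfl, fun y hy => by
      by_contra hy'
      exact h y hy' hy⟩⟩

/-- colour degree from the gadget; `F` is any graph whose outer edges at `φ i` are described by `si`. -/
lemma cd_gadget {n : ℕ} {φ : Fin n → V} (hφ : Function.Injective φ) (F : SimpleGraph V)
    (K : Fin n → Fin n → Bool) (i : Fin n) (hK : ∀ j, F.Adj (φ i) (φ j) ↔ K i j = true)
    (c : V → V → Fin 3) (κ : Fin n → Fin n → Fin 3) (hκ : ∀ j, K i j = true → c (φ i) (φ j) = κ i j)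
    (s : Fin n → Option (Fin 3 × Fin 3))
    (hst : (s i = none ∧ ∀ y, F.Adj (φ i) y → y ∈ Set.range φ) ∨
      ∃ x, x ∉ Set.range φ ∧ F.Adj (φ i) x ∧ (∀ y, F.Adj (φ i) y → y ∈ Set.range φ ∨ y = x) ∧
        ∃ D : Fin 3, s i = some (c (φ i) x, D)) (k : Fin 3) :
    cd F c k (φ i) = gdeg K s κ k i := by
  have hc := inner_count hφ (fun y => F.Adj (φ i) y ∧ c (φ i) y = k)
    (fun j => K i j = true ∧ κ i j = k) (by
      intro j
      rw [hK j]
      refine and_congr_right fun h => ?_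
      rw [hκ j h])
  unfold cd gdeg
  rw [← hc]
  rcases hst with ⟨h1, h2⟩ | ⟨x, hx, hix, hu, D, hD⟩
  · simp only [h1, Option.map_none, reduceCtorEq, if_false, add_zero]
    congr 1
    ext y
    simp only [Set.mem_ofPred_eq]
    exact ⟨fun h => ⟨h2 y h.1, h⟩, fun h => h.2⟩
  · simp only [hD, Option.map_some, Option.some.injEq]
    split_ifs with hk
    · rw [← Set.ncard_insert_of_notMem (a := x) (fun h => hx h.1) (Set.toFinite _)]
      congr 1
      ext y
      simp only [Set.mem_insert_iff, Set.mem_ofPred_eq]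
      constructor
      · intro h
        rcases hu y h.1 with h' | h'
        · exact Or.inr ⟨h', h⟩
        · exact Or.inl h'
      · rintro (rfl | h)
        · exact ⟨hix, hk⟩
        · exact h.2
    · rw [add_zero]
      congr 1
      ext y
      simp only [Set.mem_ofPred_eq]
      constructor
      · intro h
        rcases hu y h.1 with h' | h'
        · exact ⟨h', h⟩
        · subst h'; exact (hk h.2).elim
      · exact fun h => h.2

lemma gadget_col {H : SimpleGraph V} {n : ℕ} {φ : Fin n → V}
    (hφ : Function.Injective φ) (K : Fin n → Fin n → Bool)
    (hK : ∀ i j, G.Adj (φ i) (φ j) ↔ K i j = true)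
    (hW : ∀ x y, G.Adj x y → ¬ H.Adj x y → x ∈ Set.range φ ∨ y ∈ Set.range φ)
    (cH : V → V → Fin 3) (hH : GoodCol H cH)
    (c : V → V → Fin 3) (hcs : ∀ x y, c x y = c y x) (hcH : ∀ x y, H.Adj x y → c x y = cH x y)
    (hcd : ∀ x y, x ∉ Set.range φ → H.Adj x y → cd G c (c x y) x = cd H cH (c x y) x)
    (s : Fin n → Option (Fin 3 × Fin 3)) (hst : ∀ i, StateAt G c φ i (s i))
    (κ : Fin n → Fin n → Fin 3) (hv : GValid K s κ) : HasLIEC G 3 := by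
  classical
  rw [hasLIEC_iff]
  obtain ⟨v1, v2, v3⟩ := hv
  let c2 : V → V → Fin 3 := fun x y =>
    if h : (∃ i, φ i = x) ∧ (∃ j, φ j = y) then κ h.1.choose h.2.choose else c x y
  have c2in : ∀ i j, c2 (φ i) (φ j) = κ i j := by
    intro i j
    have h : (∃ i', φ i' = φ i) ∧ (∃ j', φ j' = φ j) := ⟨⟨i, rfl⟩, ⟨j, rfl⟩⟩
    have e1 := hφ h.1.choose_spec
    have e2 := hφ h.2.choose_spec
    simp only [c2, h, and_self, dif_pos]
    rw [e1, e2]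
  have c2l : ∀ x y, x ∉ Set.range φ → c2 x y = c x y := by
    intro x y hx
    simp only [c2]
    rw [dif_neg]
    rintro ⟨h, _⟩; exact hx h
  have c2r : ∀ x y, y ∉ Set.range φ → c2 x y = c x y := by
    intro x y hx
    simp only [c2]
    rw [dif_neg]
    rintro ⟨_, h⟩; exact hx h
  have c2s : ∀ x y, c2 x y = c2 y x := by
    intro x y
    by_cases hx : x ∈ Set.range φ
    · by_cases hy : y ∈ Set.range φ
      · obtain ⟨i, rfl⟩ := hx
        obtain ⟨j, rfl⟩ := hy
        rw [c2in, c2in, v1]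
      · rw [c2r _ _ hy, c2l _ _ hy, hcs]
    · rw [c2l _ _ hx, c2r _ _ hx, hcs]
  have cdo : ∀ k x, x ∉ Set.range φ → cd G c2 k x = cd G c k x := by
    intro k x hx
    unfold cd
    simp only [c2l x _ hx]
  have cdi : ∀ k i, cd G c2 k (φ i) = gdeg K s κ k i := by
    intro k i
    apply cd_gadget hφ G K i (hK i) c2 κ (fun j _ => c2in i j) s
    rcases hst i with h | ⟨x, hx, h1, h2, D, h3, h4⟩
    · exact Or.inl h
    · exact Or.inr ⟨x, hx, h1, h2, D, by rw [c2r _ _ hx]; exact h3⟩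
  have bd : ∀ i y, y ∉ Set.range φ → G.Adj (φ i) y →
      cd G c2 (c2 (φ i) y) (φ i) ≠ cd G c2 (c2 (φ i) y) y := by
    intro i y hy h
    rw [cdi, cdo _ _ hy, c2r _ _ hy]
    rcases hst i with h' | ⟨x, hx, h1, h2, D, h3, h4⟩
    · exact (hy (h'.2 y h)).elim
    · rcases h2 y h with h5 | h5
      · exact (hy h5).elim
      · subst h5
        rw [h4]
        exact v3 i _ _ h3
  refine ⟨c2, c2s, ?_⟩
  intro x y h
  by_cases hx : x ∈ Set.range φ
  · obtain ⟨i, rfl⟩ := hx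
    by_cases hy : y ∈ Set.range φ
    · obtain ⟨j, rfl⟩ := hy
      rw [cdi, cdi, c2in]
      exact v2 i j ((hK i j).1 h)
    · exact bd i y hy h
  · by_cases hy : y ∈ Set.range φ
    · obtain ⟨j, rfl⟩ := hy
      rw [c2s]
      exact (bd j x hx h.symm).symm
    · have hHxy : H.Adj x y := by
        by_contra hn
        rcases hW x y h hn with h' | h'
        · exact hx h'
        · exact hy h'
      rw [cdo _ _ hx, cdo _ _ hy, c2l _ _ hx, hcd x y hx hHxy, hcs, hcd y x hy hHxy.symm,
        hcs, hcH _ _ hHxy]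
      exact hH.2 x y hHxy

end gadget

def ee (x k : Fin 3) : ℕ := cond (x == k) 1 0

def oo (s : Option (Fin 3 × Fin 3)) (k : Fin 3) : ℕ :=
  match s with
  | none => 0
  | some (x, _) => ee x k

def ocl (s : Option (Fin 3 × Fin 3)) (d : Fin 3 → ℕ) : Bool :=
  match s with
  | none => true
  | some (x, D) => !(Nat.beq (d x) (D.val + 1))

def K6 (x y : Bool) : Fin 6 → Fin 6 → Bool :=
  ![![false, true, true, true, false, false],
    ![true, false, true, false, x, false],
    ![true, true, false, false, false, y],
    ![true, false, false, false, true, true],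
    ![false, x, false, true, false, true],
    ![false, false, y, true, true, false]]

def κ6 (uv ua ub ab vc vd cd ac bd : Fin 3) : Fin 6 → Fin 6 → Fin 3 :=
  ![![0, ua, ub, uv, 0, 0],
    ![ua, 0, ab, 0, ac, 0],
    ![ub, ab, 0, 0, 0, bd],
    ![uv, 0, 0, 0, vc, vd],
    ![0, ac, 0, vc, 0, cd],
    ![0, 0, bd, vd, cd, 0]]

def K4 : Fin 4 → Fin 4 → Bool :=
  ![![false, true, true, false],
    ![true, false, true, true],
    ![true, true, false, true],
    ![false, true, true, false]]

def κ4 (ua ub ab ta tb : Fin 3) : Fin 4 → Fin 4 → Fin 3 :=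
  ![![0, ua, ub, 0],
    ![ua, 0, ab, ta],
    ![ub, ab, 0, tb],
    ![0, ta, tb, 0]]

def bb (x : Bool) (c k : Fin 3) : ℕ := cond x (ee c k) 0

lemma oo_eq (s : Option (Fin 3 × Fin 3)) (k : Fin 3) :
    (if s.map Prod.fst = some k then 1 else 0) = oo s k := by
  rcases s with _ | ⟨x, D⟩
  · simp [oo]
  · by_cases h : x = k
    · simp [oo, ee, h]
    · have h' : (x == k) = false := by simpa using h
      simp [oo, ee, h, h']

lemma oo_none (k : Fin 3) : oo none k = 0 := rfl

lemma ite_ee (x k : Fin 3) : (if x = k then 1 else 0) = ee x k := by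
  by_cases h : x = k
  · simp [ee, h]
  · have h' : (x == k) = false := by simpa using h
    simp [ee, h, h']

lemma ite_bb (b : Bool) (x k : Fin 3) : (if b = true ∧ x = k then 1 else 0) = bb b x k := by
  cases b
  · simp [bb]
  · simp [bb, ite_ee]

def D6 (x y : Bool) (s : Fin 6 → Option (Fin 3 × Fin 3)) (uv ua ub ab vc vd cd ac bd : Fin 3)
    (k : Fin 3) : Fin 6 → ℕ :=
  ![ee ua k + ee ub k + ee uv k + oo (s 0) k,
    ee ua k + ee ab k + bb x ac k + oo (s 1) k,
    ee ub k + ee ab k + bb y bd k + oo (s 2) k,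
    ee uv k + ee vc k + ee vd k + oo (s 3) k,
    bb x ac k + ee vc k + ee cd k + oo (s 4) k,
    bb y bd k + ee vd k + ee cd k + oo (s 5) k]

lemma gdeg6 (x y : Bool) (s : Fin 6 → Option (Fin 3 × Fin 3)) (uv ua ub ab vc vd cd ac bd : Fin 3)
    (k : Fin 3) (i : Fin 6) :
    gdeg (K6 x y) s (κ6 uv ua ub ab vc vd cd ac bd) k i = D6 x y s uv ua ub ab vc vd cd ac bd k i := by
  unfold gdeg
  rw [oo_eq, Finset.card_filter]
  simp only [ite_bb, Fin.sum_univ_six]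
  fin_cases i <;> simp [K6, κ6, D6, bb]

def D4 (s : Fin 4 → Option (Fin 3 × Fin 3)) (ua ub ab ta tb : Fin 3) (k : Fin 3) : Fin 4 → ℕ :=
  ![ee ua k + ee ub k + oo (s 0) k,
    ee ua k + ee ab k + ee ta k + oo (s 1) k,
    ee ub k + ee ab k + ee tb k + oo (s 2) k,
    ee ta k + ee tb k + oo (s 3) k]

lemma gdeg4 (s : Fin 4 → Option (Fin 3 × Fin 3)) (ua ub ab ta tb : Fin 3)
    (k : Fin 3) (i : Fin 4) :
    gdeg K4 s (κ4 ua ub ab ta tb) k i = D4 s ua ub ab ta tb k i := by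
  unfold gdeg
  rw [oo_eq, Finset.card_filter]
  simp only [ite_bb, Fin.sum_univ_four]
  fin_cases i <;> simp [K4, κ4, D4, bb]

lemma ocl_iff (s : Option (Fin 3 × Fin 3)) (d : Fin 3 → ℕ) :
    ocl s d = true ↔ ∀ k D, s = some (k, D) → d k ≠ D.val + 1 := by
  rcases s with _ | ⟨x, D⟩
  · simp [ocl]
  · simp only [ocl, Bool.not_eq_true', Option.some.injEq, Prod.mk.injEq]
    rw [← Bool.not_eq_true, Nat.beq_eq]
    constructor
    · rintro h k D' ⟨rfl, rfl⟩; exact h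
    · intro h; exact h _ _ ⟨rfl, rfl⟩

def nb (a b : ℕ) : Bool := !(Nat.beq a b)

lemma nb_iff (a b : ℕ) : nb a b = true ↔ a ≠ b := by
  simp only [nb, Bool.not_eq_true']
  rw [← Bool.not_eq_true, Nat.beq_eq]

/-- validity for the six-vertex gadgets -/
lemma valid6 (x y : Bool) (s : Fin 6 → Option (Fin 3 × Fin 3)) (uv ua ub ab vc vd cd ac bd : Fin 3)
    (d : Fin 3 → Fin 6 → ℕ) (hd : d = D6 x y s uv ua ub ab vc vd cd ac bd)
    (h1 : d uv 0 ≠ d uv 3) (h2 : d ua 0 ≠ d ua 1) (h3 : d ub 0 ≠ d ub 2) (h4 : d ab 1 ≠ d ab 2)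
    (h5 : d vc 3 ≠ d vc 4) (h6 : d vd 3 ≠ d vd 5) (h7 : d cd 4 ≠ d cd 5)
    (h8 : x = true → d ac 1 ≠ d ac 4) (h9 : y = true → d bd 2 ≠ d bd 5)
    (hs : ∀ i, ocl (s i) (fun k => d k i) = true) :
    GValid (K6 x y) s (κ6 uv ua ub ab vc vd cd ac bd) := by
  refine ⟨?_, ?_, ?_⟩
  · intro i j
    fin_cases i <;> fin_cases j <;> rfl
  · intro i j hij
    rw [gdeg6, gdeg6, ← hd]
    fin_cases i <;> fin_cases j <;> first
      | exact absurd hij Bool.false_ne_true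
      | exact h1 | exact h2 | exact h3 | exact h4 | exact h5 | exact h6 | exact h7
      | exact h8 hij | exact h9 hij
      | exact h1.symm | exact h2.symm | exact h3.symm | exact h4.symm | exact h5.symm
      | exact h6.symm | exact h7.symm
      | exact (h8 hij).symm | exact (h9 hij).symm
  · intro i k D h
    rw [gdeg6, ← hd]
    exact (ocl_iff _ _).1 (hs i) k D h

lemma valid4 (s : Fin 4 → Option (Fin 3 × Fin 3)) (ua ub ab ta tb : Fin 3)
    (d : Fin 3 → Fin 4 → ℕ) (hd : d = D4 s ua ub ab ta tb)
    (h2 : d ua 0 ≠ d ua 1) (h3 : d ub 0 ≠ d ub 2) (h4 : d ab 1 ≠ d ab 2)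
    (h5 : d ta 3 ≠ d ta 1) (h6 : d tb 3 ≠ d tb 2)
    (hs : ∀ i, ocl (s i) (fun k => d k i) = true) :
    GValid K4 s (κ4 ua ub ab ta tb) := by
  refine ⟨?_, ?_, ?_⟩
  · intro i j
    fin_cases i <;> fin_cases j <;> rfl
  · intro i j hij
    rw [gdeg4, gdeg4, ← hd]
    fin_cases i <;> fin_cases j <;> first
      | exact absurd hij Bool.false_ne_true
      | exact h2 | exact h3 | exact h4 | exact h5 | exact h6
      | exact h2.symm | exact h3.symm | exact h4.symm | exact h5.symm
      | exact h6.symm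
  · intro i k D h
    rw [gdeg4, ← hd]
    exact (ocl_iff _ _).1 (hs i) k D h

/-! finite checks -/

def LOK (sa sb : Option (Fin 3 × Fin 3)) (i ua ub ab : Fin 3) : Bool :=
  let dU := fun k => ee ua k + ee ub k + ee i k
  let dA := fun k => ee ua k + ee ab k + oo sa k
  let dB := fun k => ee ub k + ee ab k + oo sb k
  Nat.beq (dU i) 2 && nb (dU ua) (dA ua) && nb (dU ub) (dB ub) && nb (dA ab) (dB ab)
    && ocl sa dA && ocl sb dB

def ROK (sa sb : Option (Fin 3 × Fin 3)) (i ua ub ab : Fin 3) : Bool :=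
  let dU := fun k => ee i k + ee ua k + ee ub k
  let dA := fun k => ee ua k + ee ab k + oo sa k
  let dB := fun k => ee ub k + ee ab k + oo sb k
  nb 2 (dU i) && nb (dU ua) (dA ua) && nb (dU ub) (dB ub) && nb (dA ab) (dB ab)
    && ocl sa dA && ocl sb dB

def OldR (sa sb : Option (Fin 3 × Fin 3)) (ua ub ab : Fin 3) : Bool :=
  let dU := fun k => ee ua k + ee ub k
  let dA := fun k => ee ua k + ee ab k + oo sa k
  let dB := fun k => ee ub k + ee ab k + oo sb k
  nb (dU ua) (dA ua) && nb (dU ub) (dB ub) && nb (dA ab) (dB ab)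
    && ocl sa dA && ocl sb dB

lemma finL : ∀ sa sb : Option (Fin 3 × Fin 3), ∃ x : Fin 3, ∀ i, i ≠ x →
    ∃ ua ub ab : Fin 3, LOK sa sb i ua ub ab = true := by
  decide +kernel

lemma finR : ∀ sa sb : Option (Fin 3 × Fin 3), (∃ p q r : Fin 3, OldR sa sb p q r = true) →
    ∃ x : Fin 3, ∀ i, i ≠ x → ∃ ua ub ab : Fin 3, ROK sa sb i ua ub ab = true := by
  decide +kernel

def OK2 (su st : Option (Fin 3 × Fin 3)) (ua ub ab ta tb : Fin 3) : Bool :=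
  let dU := fun k => ee ua k + ee ub k + oo su k
  let dA := fun k => ee ua k + ee ab k + ee ta k
  let dB := fun k => ee ub k + ee ab k + ee tb k
  let dT := fun k => ee ta k + ee tb k + oo st k
  nb (dU ua) (dA ua) && nb (dU ub) (dB ub) && nb (dA ab) (dB ab) && nb (dT ta) (dA ta)
    && nb (dT tb) (dB tb) && ocl su dU && ocl st dT

lemma fin2 : ∀ su st : Option (Fin 3 × Fin 3), ∃ ua ub ab ta tb : Fin 3,
    OK2 su st ua ub ab ta tb = true := by
  decide +kernel

def OK3 (sb sd : Option (Fin 3 × Fin 3)) (uv ua ub ab vc vd cd ac : Fin 3) : Bool :=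
  let dU := fun k => ee ua k + ee ub k + ee uv k
  let dA := fun k => ee ua k + ee ab k + ee ac k
  let dB := fun k => ee ub k + ee ab k + oo sb k
  let dV := fun k => ee uv k + ee vc k + ee vd k
  let dC := fun k => ee ac k + ee vc k + ee cd k
  let dD := fun k => ee vd k + ee cd k + oo sd k
  nb (dU uv) (dV uv) && nb (dU ua) (dA ua) && nb (dU ub) (dB ub) && nb (dA ab) (dB ab)
    && nb (dV vc) (dC vc) && nb (dV vd) (dD vd) && nb (dC cd) (dD cd) && nb (dA ac) (dC ac)
    && ocl sb dB && ocl sd dD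

def tab3 : Fin 9 → Fin 8 → Fin 3 :=
  ![![0, 0, 1, 1, 2, 1, 1, 2], ![0, 0, 2, 2, 1, 2, 2, 1], ![1, 1, 0, 0, 2, 0, 0, 2],
    ![0, 0, 0, 1, 0, 2, 2, 1], ![0, 0, 1, 1, 0, 0, 2, 2], ![0, 1, 2, 2, 1, 0, 1, 1],
    ![0, 0, 0, 1, 0, 2, 0, 0], ![0, 0, 0, 1, 1, 0, 1, 1], ![0, 0, 0, 2, 1, 0, 0, 1]]

lemma fin3' : ∀ sb sd : Option (Fin 3 × Fin 3), ∃ t : Fin 9,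
    OK3 sb sd (tab3 t 0) (tab3 t 1) (tab3 t 2) (tab3 t 3) (tab3 t 4) (tab3 t 5) (tab3 t 6)
      (tab3 t 7) = true := by
  decide +kernel

lemma fin3 (sb sd : Option (Fin 3 × Fin 3)) : ∃ uv ua ub ab vc vd cd ac : Fin 3,
    OK3 sb sd uv ua ub ab vc vd cd ac = true := by
  obtain ⟨t, ht⟩ := fin3' sb sd
  exact ⟨_, _, _, _, _, _, _, _, ht⟩

/-- generic gadget -/
lemma gen_solve (s : Fin 6 → Option (Fin 3 × Fin 3)) (h0 : s 0 = none) (h3 : s 3 = none)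
    (hR : ∃ p q r : Fin 3, OldR (s 4) (s 5) p q r = true) : ∃ κ, GValid (K6 false false) s κ := by
  obtain ⟨x, hx⟩ := finL (s 1) (s 2)
  obtain ⟨y, hy⟩ := finR (s 4) (s 5) hR
  obtain ⟨i, hix, hiy⟩ : ∃ i : Fin 3, i ≠ x ∧ i ≠ y := by
    clear hx hy; revert x y; decide
  obtain ⟨ua, ub, ab, hl⟩ := hx i hix
  obtain ⟨vc, vd, cd, hr⟩ := hy i hiy
  refine ⟨κ6 i ua ub ab vc vd cd 0 0, valid6 _ _ s i ua ub ab vc vd cd 0 0 _ rfl ?_ ?_ ?_ ?_ ?_ ?_ ?_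
    (by simp) (by simp) ?_⟩
  all_goals simp only [LOK, ROK, Bool.and_eq_true, nb_iff, Nat.beq_eq] at hl hr
  all_goals obtain ⟨⟨⟨⟨⟨l1, l2⟩, l3⟩, l4⟩, l5⟩, l6⟩ := hl
  all_goals obtain ⟨⟨⟨⟨⟨r1, r2⟩, r3⟩, r4⟩, r5⟩, r6⟩ := hr
  all_goals simp [D6, h0, h3, oo_none, bb] 
  · rw [l1]; exact r1
  · exact l2
  · exact l3
  · exact l4
  · exact r2
  · exact r3
  · exact r4
  · intro j
    fin_cases j
    · simp [h0, ocl]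
    · simpa using l5
    · simpa using l6
    · simp [h3, ocl]
    · simpa using r5
    · simpa using r6

lemma dia_solve (s : Fin 4 → Option (Fin 3 × Fin 3)) (h1 : s 1 = none) (h2 : s 2 = none) :
    ∃ κ, GValid K4 s κ := by
  obtain ⟨ua, ub, ab, ta, tb, h⟩ := fin2 (s 0) (s 3)
  refine ⟨κ4 ua ub ab ta tb, valid4 s ua ub ab ta tb _ rfl ?_ ?_ ?_ ?_ ?_ ?_⟩
  all_goals simp only [OK2, Bool.and_eq_true, nb_iff] at h
  all_goals obtain ⟨⟨⟨⟨⟨⟨l1, l2⟩, l3⟩, l4⟩, l5⟩, l6⟩, l7⟩ := h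
  all_goals simp [D4, h1, h2, oo_none] 
  · exact l1
  · exact l2
  · exact l3
  · exact l4
  · exact l5
  · intro j
    fin_cases j
    · simpa using l6
    · simp [h1, ocl]
    · simp [h2, ocl]
    · simpa using l7

lemma ac_solve (s : Fin 6 → Option (Fin 3 × Fin 3)) (h0 : s 0 = none) (h3 : s 3 = none)
    (h1 : s 1 = none) (h4 : s 4 = none) : ∃ κ, GValid (K6 true false) s κ := by
  obtain ⟨uv, ua, ub, ab, vc, vd, cd, ac, h⟩ := fin3 (s 2) (s 5)
  refine ⟨κ6 uv ua ub ab vc vd cd ac 0, valid6 _ _ s uv ua ub ab vc vd cd ac 0 _ rfl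
    ?_ ?_ ?_ ?_ ?_ ?_ ?_ ?_ (by simp) ?_⟩
  all_goals simp only [OK3, Bool.and_eq_true, nb_iff] at h
  all_goals obtain ⟨⟨⟨⟨⟨⟨⟨⟨⟨l1, l2⟩, l3⟩, l4⟩, l5⟩, l6⟩, l7⟩, l8⟩, l9⟩, l10⟩ := h
  all_goals simp [D6, h0, h3, h1, h4, oo_none, bb] 
  · exact l1
  · exact l2
  · exact l3
  · exact l4
  · exact l5
  · exact l6
  · exact l7
  · exact l8
  · intro j
    fin_cases j
    · simp [h0, ocl]
    · simp [h1, ocl]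
    · simpa using l9
    · simp [h3, ocl]
    · simp [h4, ocl]
    · simpa using l10

lemma prism_solve (s : Fin 6 → Option (Fin 3 × Fin 3)) (h : ∀ i, s i = none) :
    ∃ κ, GValid (K6 true true) s κ := by
  obtain rfl : s = fun _ => none := funext h
  refine ⟨κ6 0 0 0 1 0 2 2 1 0, valid6 _ _ _ 0 0 0 1 0 2 2 1 0 _ rfl ?_ ?_ ?_ ?_ ?_ ?_ ?_ ?_ ?_ ?_⟩
  all_goals decide

section main
variable {V : Type*} [Fintype V] {G : SimpleGraph V} {O : V → V → Prop}

lemma three_nb (hd : MaxDegreeLE G 3) {q x y z : V} (hx : G.Adj q x) (hy : G.Adj q y)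
    (hz : G.Adj q z) (hxy : x ≠ y) (hxz : x ≠ z) (hyz : y ≠ z) {w : V} (hw : G.Adj q w) :
    w = x ∨ w = y ∨ w = z := by
  classical
  by_contra hcon
  push Not at hcon
  have h1 : (({x, y, z, w} : Finset V) : Set V) ⊆ G.neighborSet q := by
    intro p hp
    simp only [Finset.coe_insert, Finset.coe_singleton, Set.mem_insert_iff,
      Set.mem_singleton_iff] at hp
    rcases hp with rfl | rfl | rfl | rfl <;> assumption
  have h2 := Set.ncard_le_ncard h1 (Set.toFinite _)
  rw [Set.ncard_coe_finset] at h2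
  have h3 : ({x, y, z, w} : Finset V).card = 4 := by
    rw [Finset.card_eq_of_equiv_fin]
    exact (Finset.equivFinOfCardEq (by
      rw [Finset.card_insert_of_notMem, Finset.card_insert_of_notMem,
        Finset.card_insert_of_notMem, Finset.card_singleton]
      · simpa using hcon.2.2.symm
      · simp only [Finset.mem_insert, Finset.mem_singleton, not_or]
        exact ⟨hyz, hcon.2.1.symm⟩
      · simp only [Finset.mem_insert, Finset.mem_singleton, not_or]
        exact ⟨hxy, hxz, hcon.1.symm⟩))
  have := hd q
  omega

lemma state_none {c : V → V → Fin 3} {n : ℕ} {φ : Fin n → V} {i : Fin n}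
    {si : Option (Fin 3 × Fin 3)} (h : StateAt G c φ i si)
    (hi : ∀ y, G.Adj (φ i) y → y ∈ Set.range φ) : si = none := by
  rcases h with h | ⟨x, hx, hix, _⟩
  · exact h.1
  · exact absurd (hi x hix) hx

lemma HT_adj (hO : IsOri G O) {T : Set V} {x y : V} (h : G.Adj x y) (hx : x ∉ T) (hy : y ∉ T) :
    (HT O hO.2.2.1 T).Adj x y := by
  rcases hO.2.1 _ _ h with h | h
  · exact Or.inl ⟨h, hx⟩
  · exact Or.inr ⟨h, hy⟩

lemma core (hcl : ClawFree G) (hd : MaxDegreeLE G 3)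
    (hmin : ∀ (W : Type) [Fintype W] (H : SimpleGraph W),
      Decomposable H → ClawFree H → MaxDegreeLE H 3 →
      H.edgeSet.ncard < G.edgeSet.ncard → HasLIEC H 3)
    (hO : IsOri G O) {n : ℕ} {φ : Fin n → V} (hφ : Function.Injective φ)
    (K : Fin n → Fin n → Bool) (hK : ∀ i j, G.Adj (φ i) (φ j) ↔ K i j = true)
    (hK2 : ∀ i, 2 ≤ (Finset.univ.filter (fun j => K i j = true)).card)
    (T : Set V) (hT : T ⊆ Set.range φ) {p q : V} (hp : p ∈ T) (hq : q ∈ T) (hpq : G.Adj p q)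
    (hc : ∀ x y z, x ∉ T → y ∈ T → O x y → (HT O hO.2.2.1 T).Adj x z → G.Adj y z → False)
    (hsolve : ∀ (cH c : V → V → Fin 3) (s : Fin n → Option (Fin 3 × Fin 3)),
      GoodCol (HT O hO.2.2.1 T) cH → (∀ x y, (HT O hO.2.2.1 T).Adj x y → c x y = cH x y) →
      (∀ x y, x ∉ Set.range φ → (HT O hO.2.2.1 T).Adj x y →
        cd G c (c x y) x = cd (HT O hO.2.2.1 T) cH (c x y) x) →
      (∀ i, StateAt G c φ i (s i)) → ∃ κ, GValid K s κ) : HasLIEC G 3 := by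
  have hlt : HT O hO.2.2.1 T < G := by
    rcases hO.2.1 _ _ hpq with h | h
    · exact HT_lt hO T hp h
    · exact HT_lt hO T hq h
  have h1 := min_transport G hmin _ (HT_dec hO T) (HT_claw hO T hcl hc) hlt hd
  rw [hasLIEC_iff] at h1
  obtain ⟨cH, hcH⟩ := h1
  have hW : ∀ x y, G.Adj x y → ¬ (HT O hO.2.2.1 T).Adj x y → x ∈ Set.range φ ∨ y ∈ Set.range φ := by
    intro x y hxy hn
    by_contra hcon
    push Not at hcon
    exact hn (HT_adj hO hxy (fun h => hcon.1 (hT h)) (fun h => hcon.2 (hT h)))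
  obtain ⟨c, c1, c2, c3⟩ := fresh_ext hd (HT_le hO T) (Set.range φ) hW cH hcH.1
  choose s hs using fun i => state_exists hd hφ K hK hK2 c c1 i
  obtain ⟨κ, hκ⟩ := hsolve cH c s hcH c2 c3 hs
  exact gadget_col hφ K hK hW cH hcH c c1 c2 c3 s hs κ hκ

structure Cfg (G : SimpleGraph V) (u a b v c d : V) : Prop where
  uv : G.Adj u v
  ua : G.Adj u a
  ub : G.Adj u b
  ab : G.Adj a b
  vc : G.Adj v c
  vd : G.Adj v d
  cd : G.Adj c d
  ac' : a ≠ c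
  ad' : a ≠ d
  bc' : b ≠ c
  bd' : b ≠ d
  uc' : u ≠ c
  ud' : u ≠ d
  va' : v ≠ a
  vb' : v ≠ b

variable {u a b v c d : V}

lemma Cfg.swap (h : Cfg G u a b v c d) : Cfg G v c d u a b :=
  ⟨h.uv.symm, h.vc, h.vd, h.cd, h.ua, h.ub, h.ab, h.ac'.symm, h.bc'.symm, h.ad'.symm, h.bd'.symm,
    h.va', h.vb', h.uc', h.ud'⟩

lemma Cfg.swab (h : Cfg G u a b v c d) : Cfg G u b a v c d :=
  ⟨h.uv, h.ub, h.ua, h.ab.symm, h.vc, h.vd, h.cd, h.bc', h.bd', h.ac', h.ad', h.uc', h.ud',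
    h.vb', h.va'⟩

lemma Cfg.swcd (h : Cfg G u a b v c d) : Cfg G u a b v d c :=
  ⟨h.uv, h.ua, h.ub, h.ab, h.vd, h.vc, h.cd.symm, h.ad', h.ac', h.bd', h.bc', h.ud', h.uc',
    h.va', h.vb'⟩

lemma Cfg.Nu (h : Cfg G u a b v c d) (hd : MaxDegreeLE G 3) {w : V} (hw : G.Adj u w) :
    w = v ∨ w = a ∨ w = b :=
  three_nb hd h.uv h.ua h.ub h.va' h.vb' h.ab.ne hw

lemma Cfg.inj (h : Cfg G u a b v c d) : Function.Injective ![u, a, b, v, c, d] := by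
  have e1 := h.uv.ne
  have e2 := h.ua.ne
  have e3 := h.ub.ne
  have e4 := h.ab.ne
  have e5 := h.vc.ne
  have e6 := h.vd.ne
  have e7 := h.cd.ne
  obtain ⟨-, -, -, -, -, -, -, f1, f2, f3, f4, f5, f6, f7, f8⟩ := h
  intro i j hij
  fin_cases i <;> fin_cases j <;> first
    | rfl
    | (exfalso; simp at hij; first | exact absurd hij ‹_› | exact absurd hij.symm ‹_›)

lemma Cfg.hK (h : Cfg G u a b v c d) (hd : MaxDegreeLE G 3) (x y : Bool)
    (hac : G.Adj a c ↔ x = true) (hbd : G.Adj b d ↔ y = true) (had : ¬ G.Adj a d)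
    (hbc : ¬ G.Adj b c) (i j : Fin 6) :
    G.Adj (![u, a, b, v, c, d] i) (![u, a, b, v, c, d] j) ↔ K6 x y i j = true := by
  have n1 : ¬ G.Adj u c := fun hh => by
    rcases h.Nu hd hh with e | e | e
    · exact h.vc.ne e.symm
    · exact h.ac' e.symm
    · exact h.bc' e.symm
  have n2 : ¬ G.Adj u d := fun hh => by
    rcases h.Nu hd hh with e | e | e
    · exact h.vd.ne e.symm
    · exact h.ad' e.symm
    · exact h.bd' e.symm
  have n3 : ¬ G.Adj v a := fun hh => by
    rcases h.swap.Nu hd hh with e | e | e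
    · exact h.ua.ne e.symm
    · exact h.ac' e
    · exact h.ad' e
  have n4 : ¬ G.Adj v b := fun hh => by
    rcases h.swap.Nu hd hh with e | e | e
    · exact h.ub.ne e.symm
    · exact h.bc' e
    · exact h.bd' e
  have hca : G.Adj c a ↔ x = true := by rw [G.adj_comm, hac]
  have hdb : G.Adj d b ↔ y = true := by rw [G.adj_comm, hbd]
  have m1 : ¬ G.Adj c u := fun hh => n1 hh.symm
  have m2 : ¬ G.Adj d u := fun hh => n2 hh.symm
  have m3 : ¬ G.Adj a v := fun hh => n3 hh.symm
  have m4 : ¬ G.Adj b v := fun hh => n4 hh.symm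
  have m5 : ¬ G.Adj d a := fun hh => had hh.symm
  have m6 : ¬ G.Adj c b := fun hh => hbc hh.symm
  obtain ⟨p1, p2, p3, p4, p5, p6, p7, -⟩ := h
  fin_cases i <;> fin_cases j <;>
    simp [K6, hac, hca, hbd, hdb, had, hbc, n1, n2, n3, n4, m1, m2, m3, m4, m5, m6,
      p1, p2, p3, p4, p5, p6, p7, p1.symm, p2.symm, p3.symm, p4.symm, p5.symm, p6.symm, p7.symm]

lemma K6_two (x y : Bool) (i : Fin 6) :
    2 ≤ (Finset.univ.filter (fun j => K6 x y i j = true)).card := by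
  revert x y i; decide

lemma K4_two (i : Fin 4) :
    2 ≤ (Finset.univ.filter (fun j => K4 i j = true)).card := by
  revert i; decide

lemma mem6 {x : V} : x ∈ Set.range ![u, a, b, v, c, d] ↔
    x = u ∨ x = a ∨ x = b ∨ x = v ∨ x = c ∨ x = d := by
  simp [Matrix.range_cons, Matrix.range_empty]
  tauto

lemma mem4 {t x : V} : x ∈ Set.range ![u, a, b, t] ↔ x = u ∨ x = a ∨ x = b ∨ x = t := by
  simp [Matrix.range_cons, Matrix.range_empty]
  tauto

lemma caseA (hcl : ClawFree G) (hd : MaxDegreeLE G 3)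
    (hmin : ∀ (W : Type) [Fintype W] (H : SimpleGraph W),
      Decomposable H → ClawFree H → MaxDegreeLE H 3 →
      H.edgeSet.ncard < G.edgeSet.ncard → HasLIEC H 3)
    (hO : IsOri G O) (h : Cfg G u a b v c d) (hac : G.Adj a c) : HasLIEC G 3 := by
  have Na : ∀ {w}, G.Adj a w → w = u ∨ w = b ∨ w = c := fun hw =>
    three_nb hd h.ua.symm h.ab hac h.ub.ne h.uc' h.bc' hw
  have Nc : ∀ {w}, G.Adj c w → w = v ∨ w = d ∨ w = a := fun hw =>
    three_nb hd h.vc.symm h.cd hac.symm h.vd.ne h.va' h.ad'.symm hw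
  have had : ¬ G.Adj a d := fun hh => by
    rcases Na hh with e | e | e
    · exact h.ud' e.symm
    · exact h.bd' e.symm
    · exact h.cd.ne e.symm
  have hbc : ¬ G.Adj b c := fun hh => by
    rcases Nc hh.symm with e | e | e
    · exact h.vb' e.symm
    · exact h.bd' e
    · exact h.ab.ne e.symm
  have Fu : ∀ y, G.Adj u y → y ∈ Set.range ![u, a, b, v, c, d] := fun y hy => by
    rw [mem6]; rcases h.Nu hd hy with e | e | e <;> simp [e]
  have Fv : ∀ y, G.Adj v y → y ∈ Set.range ![u, a, b, v, c, d] := fun y hy => by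
    rw [mem6]; rcases h.swap.Nu hd hy with e | e | e <;> simp [e]
  have Fa : ∀ y, G.Adj a y → y ∈ Set.range ![u, a, b, v, c, d] := fun y hy => by
    rw [mem6]; rcases Na hy with e | e | e <;> simp [e]
  have Fc : ∀ y, G.Adj c y → y ∈ Set.range ![u, a, b, v, c, d] := fun y hy => by
    rw [mem6]; rcases Nc hy with e | e | e <;> simp [e]
  have hle := HT_le hO (Set.range ![u, a, b, v, c, d])
  have hc : ∀ x y z, x ∉ Set.range ![u, a, b, v, c, d] → y ∈ Set.range ![u, a, b, v, c, d] →
      O x y → (HT O hO.2.2.1 (Set.range ![u, a, b, v, c, d])).Adj x z → G.Adj y z → False := by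
    intro x y z hx hy hxy hxz hyz
    have gxy := hO.1 _ _ hxy
    have gxz := hle hxz
    rw [mem6] at hy
    rcases hy with rfl | rfl | rfl | rfl | rfl | rfl
    · exact hx (Fu _ gxy.symm)
    · exact hx (Fa _ gxy.symm)
    · have k1 : u ≠ x := fun e => hx (mem6.2 (by simp [e]))
      have k2 : a ≠ x := fun e => hx (mem6.2 (by simp [e]))
      rcases three_nb hd h.ub.symm h.ab.symm gxy.symm h.ua.ne k1 k2 hyz with rfl | rfl | rfl
      · exact hx (Fu _ gxz.symm)
      · exact hx (Fa _ gxz.symm)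
      · exact gxz.ne rfl
    · exact hx (Fv _ gxy.symm)
    · exact hx (Fc _ gxy.symm)
    · have k1 : v ≠ x := fun e => hx (mem6.2 (by simp [e]))
      have k2 : c ≠ x := fun e => hx (mem6.2 (by simp [e]))
      rcases three_nb hd h.vd.symm h.cd.symm gxy.symm h.vc.ne k1 k2 hyz with rfl | rfl | rfl
      · exact hx (Fv _ gxz.symm)
      · exact hx (Fc _ gxz.symm)
      · exact gxz.ne rfl
  have hu : u ∈ Set.range ![u, a, b, v, c, d] := mem6.2 (by simp)
  have ha : a ∈ Set.range ![u, a, b, v, c, d] := mem6.2 (by simp)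
  by_cases hbd : G.Adj b d
  · refine core hcl hd hmin hO h.inj (K6 true true) (h.hK hd true true (by simpa) (by simpa) had hbc)
      (K6_two _ _) _ subset_rfl hu ha h.ua hc ?_
    intro cH c' s _ _ _ hs
    refine prism_solve s ?_
    intro i
    refine state_none (hs i) ?_
    fin_cases i
    · exact Fu
    · exact Fa
    · intro y hy
      rw [mem6]
      rcases three_nb hd h.ub.symm h.ab.symm hbd h.ua.ne h.ud' h.ad' hy with e | e | e <;> simp [e]
    · exact Fv
    · exact Fc
    · intro y hy
      rw [mem6]
      rcases three_nb hd h.vd.symm h.cd.symm hbd.symm h.vc.ne h.vb' h.bc'.symm hy with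
        e | e | e <;> simp [e]
  · refine core hcl hd hmin hO h.inj (K6 true false) (h.hK hd true false (by simpa) (by simpa) had hbc)
      (K6_two _ _) _ subset_rfl hu ha h.ua hc ?_
    intro cH c' s _ _ _ hs
    exact ac_solve s (state_none (hs 0) Fu) (state_none (hs 3) Fv) (state_none (hs 1) Fa)
      (state_none (hs 4) Fc)

lemma caseB1 (hcl : ClawFree G) (hd : MaxDegreeLE G 3)
    (hmin : ∀ (W : Type) [Fintype W] (H : SimpleGraph W),
      Decomposable H → ClawFree H → MaxDegreeLE H 3 →
      H.edgeSet.ncard < G.edgeSet.ncard → HasLIEC H 3)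
    (hO : IsOri G O) (h : Cfg G u a b v c d) {t : V} (htu : t ≠ u) (hat : G.Adj a t)
    (hbt : G.Adj b t) : HasLIEC G 3 := by
  have Na : ∀ {w}, G.Adj a w → w = u ∨ w = b ∨ w = t := fun hw =>
    three_nb hd h.ua.symm h.ab hat h.ub.ne htu.symm hbt.ne hw
  have Nb : ∀ {w}, G.Adj b w → w = u ∨ w = a ∨ w = t := fun hw =>
    three_nb hd h.ub.symm h.ab.symm hbt h.ua.ne htu.symm hat.ne hw
  have hva : ¬ G.Adj v a := fun hh => by
    rcases h.swap.Nu hd hh with e | e | e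
    · exact h.ua.ne e.symm
    · exact h.ac' e
    · exact h.ad' e
  have hvb : ¬ G.Adj v b := fun hh => by
    rcases h.swap.Nu hd hh with e | e | e
    · exact h.ub.ne e.symm
    · exact h.bc' e
    · exact h.bd' e
  have hut : ¬ G.Adj u t := fun hh => by
    rcases h.Nu hd hh with rfl | rfl | rfl
    · exact hva hat.symm
    · exact hat.ne rfl
    · exact hbt.ne rfl
  have Fa : ∀ y, G.Adj a y → y ∈ Set.range ![u, a, b, t] := fun y hy => by
    rw [mem4]; rcases Na hy with e | e | e <;> simp [e]
  have Fb : ∀ y, G.Adj b y → y ∈ Set.range ![u, a, b, t] := fun y hy => by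
    rw [mem4]; rcases Nb hy with e | e | e <;> simp [e]
  have hle := HT_le hO (Set.range ![u, a, b, t])
  have hc : ∀ x y z, x ∉ Set.range ![u, a, b, t] → y ∈ Set.range ![u, a, b, t] →
      O x y → (HT O hO.2.2.1 (Set.range ![u, a, b, t])).Adj x z → G.Adj y z → False := by
    intro x y z hx hy hxy hxz hyz
    have gxy := hO.1 _ _ hxy
    have gxz := hle hxz
    have k1 : a ≠ x := fun e => hx (mem4.2 (by simp [e]))
    have k2 : b ≠ x := fun e => hx (mem4.2 (by simp [e]))
    rw [mem4] at hy
    rcases hy with rfl | rfl | rfl | rfl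
    · rcases three_nb hd h.ua h.ub gxy.symm h.ab.ne k1 k2 hyz with rfl | rfl | rfl
      · exact hx (Fa _ gxz.symm)
      · exact hx (Fb _ gxz.symm)
      · exact gxz.ne rfl
    · exact hx (Fa _ gxy.symm)
    · exact hx (Fb _ gxy.symm)
    · rcases three_nb hd hat.symm hbt.symm gxy.symm h.ab.ne k1 k2 hyz with rfl | rfl | rfl
      · exact hx (Fa _ gxz.symm)
      · exact hx (Fb _ gxz.symm)
      · exact gxz.ne rfl
  have hu : u ∈ Set.range ![u, a, b, t] := mem4.2 (by simp)
  have ha : a ∈ Set.range ![u, a, b, t] := mem4.2 (by simp)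
  have hinj : Function.Injective ![u, a, b, t] := by
    have e2 := h.ua.ne
    have e3 := h.ub.ne
    have e4 := h.ab.ne
    have e5 := hat.ne
    have e6 := hbt.ne
    intro i j hij
    fin_cases i <;> fin_cases j <;> first
      | rfl
      | (exfalso; simp at hij; first | exact absurd hij ‹_› | exact absurd hij.symm ‹_›)
  have hK : ∀ i j, G.Adj (![u, a, b, t] i) (![u, a, b, t] j) ↔ K4 i j = true := by
    intro i j
    have htu' : ¬ G.Adj t u := fun hh => hut hh.symm
    obtain ⟨p1, p2, p3, p4, p5, p6, p7, -⟩ := h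
    fin_cases i <;> fin_cases j <;>
      simp [K4, hut, htu', p2, p3, p4, p2.symm, p3.symm, p4.symm,
        hat, hbt, hat.symm, hbt.symm]
  refine core hcl hd hmin hO hinj K4 hK K4_two _ subset_rfl hu ha h.ua hc ?_
  intro cH c' s _ _ _ hs
  exact dia_solve s (state_none (hs 1) Fa) (state_none (hs 2) Fb)

def Kold : Fin 6 → Fin 6 → Bool :=
  ![![false, false, false, false, false, false],
    ![false, false, false, false, false, false],
    ![false, false, false, false, false, false],
    ![false, false, false, false, true, true],
    ![false, false, false, true, false, true],
    ![false, false, false, true, true, false]]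

lemma caseB2 (hcl : ClawFree G) (hd : MaxDegreeLE G 3)
    (hmin : ∀ (W : Type) [Fintype W] (H : SimpleGraph W),
      Decomposable H → ClawFree H → MaxDegreeLE H 3 →
      H.edgeSet.ncard < G.edgeSet.ncard → HasLIEC H 3)
    (hO : IsOri G O) (h : Cfg G u a b v c d) (hac : ¬ G.Adj a c) (had : ¬ G.Adj a d)
    (hbc : ¬ G.Adj b c) (hbd : ¬ G.Adj b d) (ht : ∀ t, t ≠ u → G.Adj a t → G.Adj b t → False)
    (huv : O u v) : HasLIEC G 3 := by
  have hK := h.hK hd false false (by simpa) (by simpa) had hbc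
  have hle := HT_le hO {u, a, b}
  have Fu : ∀ y, G.Adj u y → y ∈ Set.range ![u, a, b, v, c, d] := fun y hy => by
    rw [mem6]; rcases h.Nu hd hy with e | e | e <;> simp [e]
  have Fv : ∀ y, G.Adj v y → y ∈ Set.range ![u, a, b, v, c, d] := fun y hy => by
    rw [mem6]; rcases h.swap.Nu hd hy with e | e | e <;> simp [e]
  refine core hcl hd hmin hO h.inj (K6 false false) hK (K6_two _ _) {u, a, b} ?_ (p := u) (q := a)
    (by simp) (by simp) h.ua ?_ ?_
  · rintro x (rfl | rfl | rfl) <;> simp [mem6]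
  · intro x y z hx hy hxy hxz hyz
    have gxy := hO.1 _ _ hxy
    have gxz := hle hxz
    simp only [Set.mem_insert_iff, Set.mem_singleton_iff, not_or] at hx
    have nxu : y ≠ u → ¬ G.Adj x u := fun hy' hh => by
      rcases h.Nu hd hh.symm with e | e | e
      · subst e
        rcases h.swap.Nu hd gxy with e | e | e
        · exact hy' e
        · subst e
          rcases hy with e | e | e
          · exact hy' e
          · exact h.ac' e.symm
          · exact h.bc' e.symm
        · subst e
          rcases hy with e | e | e
          · exact hy' e
          · exact h.ad' e.symm
          · exact h.bd' e.symm
      · exact hx.2.1 e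
      · exact hx.2.2 e
    rcases hy with rfl | rfl | rfl
    · rcases h.Nu hd gxy.symm with rfl | e | e
      · exact hO.2.2.1 _ _ huv hxy
      · exact hx.2.1 e
      · exact hx.2.2 e
    · rcases three_nb hd h.ua.symm h.ab gxy.symm h.ub.ne (Ne.symm hx.1) (Ne.symm hx.2.2) hyz with
        rfl | rfl | rfl
      · exact nxu h.ua.ne.symm gxz
      · exact ht x hx.1 gxy.symm gxz.symm
      · exact gxz.ne rfl
    · rcases three_nb hd h.ub.symm h.ab.symm gxy.symm h.ua.ne (Ne.symm hx.1) (Ne.symm hx.2.1) hyz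
        with rfl | rfl | rfl
      · exact nxu h.ub.ne.symm gxz
      · exact ht x hx.1 gxz.symm gxy.symm
      · exact gxz.ne rfl
  · intro cH c' s hcH hcc hcd hs
    have s3 : s 3 = none := state_none (hs 3) Fv
    refine gen_solve s (state_none (hs 0) Fu) s3
      ⟨cH v c, cH v d, cH c d, ?_⟩
    have hvT : v ∉ ({u, a, b} : Set V) := by
      simp only [Set.mem_insert_iff, Set.mem_singleton_iff, not_or]
      exact ⟨h.uv.ne.symm, h.va', h.vb'⟩
    have hcT : c ∉ ({u, a, b} : Set V) := by
      simp only [Set.mem_insert_iff, Set.mem_singleton_iff, not_or]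
      exact ⟨h.uc'.symm, h.ac'.symm, h.bc'.symm⟩
    have hdT : d ∉ ({u, a, b} : Set V) := by
      simp only [Set.mem_insert_iff, Set.mem_singleton_iff, not_or]
      exact ⟨h.ud'.symm, h.ad'.symm, h.bd'.symm⟩
    have Hvc := HT_adj hO h.vc hvT hcT
    have Hvd := HT_adj hO h.vd hvT hdT
    have Hcd := HT_adj hO h.cd hcT hdT
    have Hvu : ¬ (HT O hO.2.2.1 {u, a, b}).Adj v u := by
      rintro (h1 | h1)
      · exact hO.2.2.1 _ _ huv h1.1
      · exact h1.2 (by simp)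
    have hKo : ∀ i j, 3 ≤ i → ((HT O hO.2.2.1 {u, a, b}).Adj (![u, a, b, v, c, d] i)
        (![u, a, b, v, c, d] j) ↔ Kold i j = true) := by
      intro i j hi
      have key : K6 false false i j = false → ¬ (HT O hO.2.2.1 {u, a, b}).Adj (![u, a, b, v, c, d] i)
        (![u, a, b, v, c, d] j) := fun h1 h2 => by
        have := (hK i j).1 (hle h2)
        rw [h1] at this
        exact Bool.false_ne_true this
      fin_cases i <;> try exact absurd hi (by decide)
      all_goals
        fin_cases j <;> first
        | exact iff_of_false (key rfl) Bool.false_ne_true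
        | exact iff_of_true Hvc rfl
        | exact iff_of_true Hvd rfl
        | exact iff_of_true Hcd rfl
        | exact iff_of_true Hvc.symm rfl
        | exact iff_of_true Hvd.symm rfl
        | exact iff_of_true Hcd.symm rfl
        | exact iff_of_false Hvu Bool.false_ne_true
    -- degrees in `H`
    have hout : ∀ i, 3 ≤ i → ∀ x, x ∉ Set.range ![u, a, b, v, c, d] →
        G.Adj (![u, a, b, v, c, d] i) x →
        (HT O hO.2.2.1 {u, a, b}).Adj (![u, a, b, v, c, d] i) x := by
      intro i hi x hx hix
      refine HT_adj hO hix ?_ ?_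
      · fin_cases i <;> first | exact absurd hi (by decide) | exact hvT | exact hcT | exact hdT
      · rintro (rfl | rfl | rfl) <;> exact hx (mem6.2 (by simp))
    have hdeg : ∀ i, 3 ≤ i → ∀ k, cd (HT O hO.2.2.1 {u, a, b}) cH k (![u, a, b, v, c, d] i) =
        gdeg Kold s (fun i j => cH (![u, a, b, v, c, d] i) (![u, a, b, v, c, d] j)) k i := by
      intro i hi k
      refine cd_gadget h.inj _ Kold i (fun j => hKo i j hi) cH _ (fun j _ => rfl) s ?_ k
      rcases hs i with h1 | ⟨x, x1, x2, x3, D, x4, _⟩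
      · exact Or.inl ⟨h1.1, fun y hy => h1.2 y (hle hy)⟩
      · refine Or.inr ⟨x, x1, hout i hi x x1 x2, fun y hy => x3 y (hle hy), D, ?_⟩
        rw [x4, hcc _ _ (hout i hi x x1 x2)]
    have hocl : ∀ i, 3 ≤ i → ocl (s i) (fun k => gdeg Kold s
        (fun i j => cH (![u, a, b, v, c, d] i) (![u, a, b, v, c, d] j)) k i) = true := by
      intro i hi
      rw [ocl_iff]
      intro k D hk
      rw [← hdeg i hi]
      rcases hs i with h1 | ⟨x, x1, x2, x3, D', x4, x5⟩
      · rw [h1.1] at hk; cases hk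
      · have Hx := hout i hi x x1 x2
        rw [x4] at hk
        simp only [Option.some.injEq, Prod.mk.injEq] at hk
        obtain ⟨rfl, rfl⟩ := hk
        have y1 := hcH.2 _ _ Hx
        have y2 := hcd x _ x1 Hx.symm
        rw [hcc _ _ Hx.symm, hcH.1] at y2
        rw [hcc _ _ Hx] at x5 ⊢
        rw [← x5, y2]
        exact y1
    have g3 : ∀ k, gdeg Kold s (fun i j => cH (![u, a, b, v, c, d] i) (![u, a, b, v, c, d] j)) k 3
        = ee (cH v c) k + ee (cH v d) k := by
      intro k
      unfold gdeg
      rw [oo_eq, Finset.card_filter]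
      simp only [ite_bb, Fin.sum_univ_six]
      simp [Kold, bb, s3, oo_none]
    have g4 : ∀ k, gdeg Kold s (fun i j => cH (![u, a, b, v, c, d] i) (![u, a, b, v, c, d] j)) k 4
        = ee (cH v c) k + ee (cH c d) k + oo (s 4) k := by
      intro k
      unfold gdeg
      rw [oo_eq, Finset.card_filter]
      simp only [ite_bb, Fin.sum_univ_six]
      simp [Kold, bb, hcH.1 c v]
    have g5 : ∀ k, gdeg Kold s (fun i j => cH (![u, a, b, v, c, d] i) (![u, a, b, v, c, d] j)) k 5
        = ee (cH v d) k + ee (cH c d) k + oo (s 5) k := by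
      intro k
      unfold gdeg
      rw [oo_eq, Finset.card_filter]
      simp only [ite_bb, Fin.sum_univ_six]
      simp [Kold, bb, hcH.1 d v, hcH.1 d c]
    have d3 := fun k => (hdeg 3 (by decide) k).trans (g3 k)
    have d4 := fun k => (hdeg 4 (by decide) k).trans (g4 k)
    have d5 := fun k => (hdeg 5 (by decide) k).trans (g5 k)
    have o4 := hocl 4 (by decide)
    have o5 := hocl 5 (by decide)
    simp only [g4] at o4
    simp only [g5] at o5
    have z1 := hcH.2 _ _ Hvc
    have z2 := hcH.2 _ _ Hvd
    have z3 := hcH.2 _ _ Hcd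
    simp only [OldR, Bool.and_eq_true, nb_iff]
    refine ⟨⟨⟨⟨?_, ?_⟩, ?_⟩, o4⟩, o5⟩
    · rw [← d3, ← d4]; exact z1
    · rw [← d3, ← d5]; exact z2
    · rw [← d4, ← d5]; exact z3

lemma caseB (hcl : ClawFree G) (hd : MaxDegreeLE G 3)
    (hmin : ∀ (W : Type) [Fintype W] (H : SimpleGraph W),
      Decomposable H → ClawFree H → MaxDegreeLE H 3 →
      H.edgeSet.ncard < G.edgeSet.ncard → HasLIEC H 3)
    (hO : IsOri G O) (h : Cfg G u a b v c d) (huv : O u v) : HasLIEC G 3 := by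
  by_cases hac : G.Adj a c
  · exact caseA hcl hd hmin hO h hac
  by_cases had : G.Adj a d
  · exact caseA hcl hd hmin hO h.swcd had
  by_cases hbc : G.Adj b c
  · exact caseA hcl hd hmin hO h.swab hbc
  by_cases hbd : G.Adj b d
  · exact caseA hcl hd hmin hO h.swab.swcd hbd
  by_cases ht : ∃ t, t ≠ u ∧ G.Adj a t ∧ G.Adj b t
  · obtain ⟨t, h1, h2, h3⟩ := ht
    exact caseB1 hcl hd hmin hO h h1 h2 h3
  · exact caseB2 hcl hd hmin hO h hac had hbc hbd (fun t h1 h2 h3 => ht ⟨t, h1, h2, h3⟩) huv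

lemma get_nbs (hcl : ClawFree G) (huv : G.Adj u v) (hu : (G.neighborSet u).ncard = 3)
    (hno : ∀ w, G.Adj u w → ¬ G.Adj v w) :
    ∃ a b, G.Adj u a ∧ G.Adj u b ∧ G.Adj a b ∧ v ≠ a ∧ v ≠ b := by
  have aux : ∀ a b, v ≠ a → v ≠ b → a ≠ b → G.Adj u a → G.Adj u b →
      ∃ a b, G.Adj u a ∧ G.Adj u b ∧ G.Adj a b ∧ v ≠ a ∧ v ≠ b := by
    intro a b h1 h2 h3 h4 h5
    refine ⟨a, b, h4, h5, ?_, h1, h2⟩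
    by_contra hab
    exact hcl ⟨u, v, a, b, h1, h2, h3, huv, h4, h5, hno a h4, hno b h5, hab⟩
  rw [Set.ncard_eq_three] at hu
  obtain ⟨x, y, z, hxy, hxz, hyz, he⟩ := hu
  have hm : ∀ w, G.Adj u w ↔ w = x ∨ w = y ∨ w = z := fun w => by
    rw [← SimpleGraph.mem_neighborSet, he]; simp
  rcases (hm v).1 huv with rfl | rfl | rfl
  · exact aux y z hxy hxz hyz ((hm _).2 (by simp)) ((hm _).2 (by simp))
  · exact aux x z hxy.symm hyz hxz ((hm _).2 (by simp)) ((hm _).2 (by simp))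
  · exact aux x y hxz.symm hyz.symm hxy ((hm _).2 (by simp)) ((hm _).2 (by simp))

end main

/-- In a minimal counterexample to the 3-color theorem for claw-free subcubic graphs, every pair of adjacent vertices of degree 3 has a common neighbor. -/
theorem minimal_cex_adjacent_deg3_common_neighbor {V : Type*} [Fintype V] (G : SimpleGraph V)
    (hconn : G.Connected) (hdec : Decomposable G) (hclaw : ClawFree G)
    (hdeg : MaxDegreeLE G 3) (hG : ¬ HasLIEC G 3)
    (hmin : ∀ (W : Type) [Fintype W] (H : SimpleGraph W),
      Decomposable H → ClawFree H → MaxDegreeLE H 3 →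
      H.edgeSet.ncard < G.edgeSet.ncard → HasLIEC H 3) :
    ∀ u v : V, G.Adj u v → (G.neighborSet u).ncard = 3 → (G.neighborSet v).ncard = 3 →
      ∃ w : V, G.Adj u w ∧ G.Adj v w := by
  intro u v huv hu hv
  by_contra hcon
  have hno : ∀ w, G.Adj u w → ¬ G.Adj v w := fun w h1 h2 => hcon ⟨w, h1, h2⟩
  obtain ⟨k, hk⟩ := hdec
  rw [hasLIEC_iff] at hk
  obtain ⟨c0, hc0⟩ := hk
  obtain ⟨O, hO⟩ := exists_ori hclaw hdeg hc0
  obtain ⟨a, b, ua, ub, ab, va, vb⟩ := get_nbs hclaw huv hu hno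
  obtain ⟨c, d, vc, vd, cd, uc, ud⟩ := get_nbs hclaw huv.symm hv (fun w h1 h2 => hno w h2 h1)
  have h : Cfg G u a b v c d :=
    ⟨huv, ua, ub, ab, vc, vd, cd, fun e => hno a ua (e ▸ vc), fun e => hno a ua (e ▸ vd),
      fun e => hno b ub (e ▸ vc), fun e => hno b ub (e ▸ vd), uc, ud, va, vb⟩
  rcases hO.2.1 _ _ huv with h1 | h1
  · exact hG (caseB hclaw hdeg hmin hO h h1)
  · exact hG (caseB hclaw hdeg hmin hO h.swap h1)
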